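/- arXiv:1911.03279 — 7 statements merged into one kernel-verified Lean document; each statement's English description precedes it below -/
import Mathlib

section
/- If G is a finite non-abelian group of order pqr with p < q < r primes, then the number of distinct element centralizers of G equals |G'| + 2, where G' is the commutator subgroup. -/
def Cent (G : Type*) [Group G] : Set (Subgroup G) :=
  {H | ∃ x : G, H = Subgroup.centralizer {x}}

/-- If `h` generates `G` modulo `N`, every element of `G` has the form `n * h ^ k`. -/
theorem exists_mul_zpow_eq_of_zpowers_mk {G : Type*} [Group G] {N : Subgroup G} [N.Normal] {h : G}
    (hh : ∀ g : G ⧸ N, g ∈ Subgroup.zpowers (h : G ⧸ N)) (g : G) :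
    ∃ n ∈ N, ∃ k : ℤ, g = n * h ^ k := by
  obtain ⟨k, hk⟩ := hh g
  refine ⟨g * (h ^ k)⁻¹, ?_, k, by group⟩
  rw [← QuotientGroup.eq_one_iff]
  simp only [QuotientGroup.mk_mul, QuotientGroup.mk_inv, QuotientGroup.mk_zpow]
  rw [← hk]
  simp

/-- If `G'` is abelian and `h` generates `G` modulo `G'`, then `h` centralizes no nontrivial
element of `G'`. -/
theorem eq_one_of_mem_commutator_of_commute {G : Type*} [Group G] [Finite G] {h : G}
    (hN : ∀ a ∈ commutator G, ∀ b ∈ commutator G, Commute a b)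
    (hh : ∀ g : G ⧸ commutator G, g ∈ Subgroup.zpowers (h : G ⧸ commutator G))
    {n : G} (hn : n ∈ commutator G) (hnh : Commute n h) : n = 1 := by
  have key : ∀ S : Subgroup G, commutator G ≤ S → h ∈ S → S = ⊤ := by
    refine fun S hS hhS ↦ (Subgroup.eq_top_iff' S).2 fun g ↦ ?_
    obtain ⟨m, hm, k, rfl⟩ := exists_mul_zpow_eq_of_zpowers_mk hh g
    exact S.mul_mem (hS hm) (S.zpow_mem hhS k)
  have conj : ∀ g : G, ∀ a ∈ commutator G, g * a * g⁻¹ ∈ commutator G :=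
    fun g a ha ↦ (inferInstance : (commutator G).Normal).conj_mem a ha g
  let f : commutator G →* commutator G :=
    { toFun := fun a ↦ ⟨a * (h * a * h⁻¹)⁻¹, mul_mem a.2 (inv_mem (conj h a a.2))⟩
      map_one' := by simp
      map_mul' := fun a b ↦ by
        ext
        have := (hN _ (inv_mem (conj h a a.2)) _ (mul_mem b.2 (inv_mem (conj h b b.2)))).eq
        have h2 := (hN _ b.2 _ (inv_mem (conj h b b.2))).eq
        simp only [Subgroup.coe_mul]
        calc (a * b * (h * (a * b) * h⁻¹)⁻¹ : G)
            = a * ((b * (h * b * h⁻¹)⁻¹) * (h * a * h⁻¹)⁻¹) := by group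
          _ = _ := by rw [← this]; group }
  let K : Subgroup G := f.range.map (commutator G).subtype
  have memK : ∀ a ∈ commutator G, a * (h * a * h⁻¹)⁻¹ ∈ K := fun a ha ↦
    ⟨f ⟨a, ha⟩, ⟨⟨a, ha⟩, rfl⟩, rfl⟩
  have hKN : K ≤ commutator G := by
    rintro _ ⟨x, -, rfl⟩
    exact x.2
  let S : Subgroup G :=
    { carrier := {g | ∀ a ∈ commutator G, a * (g * a * g⁻¹)⁻¹ ∈ K}
      one_mem' := fun a _ ↦ by simp
      mul_mem' := fun {g g'} hg hg' a ha ↦ by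
        have := mul_mem (hg' a ha) (hg _ (conj g' a ha))
        convert this using 1
        group
      inv_mem' := fun {g} hg a ha ↦ by
        have hb := hg _ (conj g⁻¹ a ha)
        convert inv_mem hb using 1
        group }
  have hS : S = ⊤ := key S
    (fun g hg a ha ↦ by
      have : a * (g * a * g⁻¹)⁻¹ = 1 := by rw [(hN g hg a ha).eq]; group
      rw [this]; exact one_mem K) memK
  have hSK : ∀ g : G, ∀ a ∈ commutator G, a * (g * a * g⁻¹)⁻¹ ∈ K := fun g ↦
    show g ∈ S from hS ▸ Subgroup.mem_top g
  have : K.Normal := ⟨fun a ha g ↦ by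
    have := mul_mem (inv_mem (hSK g a (hKN ha))) ha
    convert this using 1
    group⟩
  have hcomm : ∀ a ∈ commutator G, ∀ g : G, Commute (a : G ⧸ K) (g : G ⧸ K) := fun a ha g ↦ by
    have := (QuotientGroup.eq_one_iff _).2 (hSK g a ha)
    simp only [QuotientGroup.mk_mul, QuotientGroup.mk_inv, mul_inv_eq_one] at this
    exact eq_mul_inv_iff_mul_eq.1 this
  have hcenter : ∀ x : G ⧸ K, (∀ a ∈ commutator G, Commute (a : G ⧸ K) x) → Commute (h : G ⧸ K) x →
      ∀ y, Commute y x := fun x h1 h2 y ↦ by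
    induction y using QuotientGroup.induction_on with
    | H y =>
      have := key ((Subgroup.centralizer {x}).comap (QuotientGroup.mk' K))
        (fun a ha ↦ Subgroup.mem_centralizer_singleton_iff.2 (h1 a ha))
        (Subgroup.mem_centralizer_singleton_iff.2 h2)
      exact Subgroup.mem_centralizer_singleton_iff.1
        (show y ∈ (Subgroup.centralizer {x}).comap (QuotientGroup.mk' K) from
          this ▸ Subgroup.mem_top y)
  have hle : commutator G ≤ K := by
    rw [← Subgroup.Normal.quotient_commutative_iff_commutator_le]
    refine ⟨⟨fun x y ↦ ?_⟩⟩
    induction y using QuotientGroup.induction_on with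
    | H y =>
      exact hcenter y (fun a ha ↦ hcomm a ha y)
        (hcenter _ (fun a ha ↦ hcomm a ha h) (.refl _) y).symm x
  have hsurj : Function.Surjective f := fun x ↦ by
    obtain ⟨_, ⟨z, rfl⟩, hz⟩ := hle x.2
    exact ⟨z, Subtype.ext hz⟩
  have hinj := Finite.injective_iff_surjective.2 hsurj
  have : f ⟨n, hn⟩ = f 1 := by
    ext
    simp [f, ← mul_assoc, hnh.eq]
  simpa using congrArg Subtype.val (hinj this)

/-- If `G'` is nontrivial, abelian with cyclic quotient, and no element outside `C_G(G')` commutes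
with a nontrivial element of `G'`, then `G` has exactly `|G'| + 2` element centralizers. -/
theorem ncard_cent_of_commute_imp {G : Type*} [Group G] [Finite G] {h : G}
    (hN : ∀ a ∈ commutator G, ∀ b ∈ commutator G, Commute a b)
    (hh : ∀ g : G ⧸ commutator G, g ∈ Subgroup.zpowers (h : G ⧸ commutator G))
    (hfree : ∀ n ∈ commutator G, ∀ y, Commute n y → n = 1 ∨ ∀ a ∈ commutator G, Commute a y)
    (hne : ∃ n ∈ commutator G, n ≠ 1) :
    (Cent G).ncard = Nat.card (commutator G) + 2 := by
  obtain ⟨n₀, hn₀, hn₀1⟩ := hne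
  have mem : ∀ {c x : G}, c ∈ Subgroup.centralizer {x} ↔ Commute c x :=
    Subgroup.mem_centralizer_singleton_iff
  have conj : ∀ g : G, ∀ a ∈ commutator G, g * a * g⁻¹ ∈ commutator G :=
    fun g a ha ↦ (inferInstance : (commutator G).Normal).conj_mem a ha g
  have hone : ∀ n ∈ commutator G, Commute n h → n = 1 :=
    fun n hn ↦ eq_one_of_mem_commutator_of_commute hN hh hn
  have hdec := exists_mul_zpow_eq_of_zpowers_mk hh
  let F : Subgroup G := Subgroup.centralizer (commutator G : Set G)
  have memF : ∀ {y : G}, y ∈ F ↔ ∀ a ∈ commutator G, Commute a y := Iff.rfl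
  have hNF : commutator G ≤ F := fun a ha ↦ memF.2 fun b hb ↦ hN b hb a ha
  have hcent : ∀ k : ℤ, h ^ k ∈ F → ∀ g : G, Commute g (h ^ k) := fun k hk g ↦ by
    obtain ⟨m, hm, j, rfl⟩ := hdec g
    exact (memF.1 hk m hm).mul_left (((Commute.refl h).zpow_left j).zpow_right k)
  have hFcomm : ∀ x ∈ F, ∀ y ∈ F, Commute x y := fun x hx y hy ↦ by
    obtain ⟨n, hn, k, rfl⟩ := hdec x
    have hk : h ^ k ∈ F := (F.mul_mem_cancel_left (hNF hn)).1 hx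
    exact (memF.1 hy n hn).mul_left (hcent k hk y).symm
  let c : commutator G → Subgroup G := fun n ↦ Subgroup.centralizer {n * h * (n : G)⁻¹}
  have memc : ∀ (n : commutator G) (x : G), x ∈ c n ↔ Commute ((n : G)⁻¹ * x * n) h := fun n x ↦ by
    rw [show x ∈ c n ↔ Commute x (n * h * (n : G)⁻¹) from mem,
      ← Commute.conj_iff (n : G) (a := (n : G)⁻¹ * x * n)]
    have : (n : G) * ((n : G)⁻¹ * x * n) * (n : G)⁻¹ = x := by group
    rw [this]
  have hn₀c : ∀ n, n₀ ∉ c n := fun n hn ↦ hn₀1 <| by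
    have h1 := (hN _ (inv_mem n.2) _ hn₀).eq
    rw [memc, h1, inv_mul_cancel_right] at hn
    exact hone n₀ hn₀ hn
  have houtside : ∀ y, y ∉ F → ∃ n, Subgroup.centralizer {y} = c n := fun y hy ↦ by
    obtain ⟨m, hm, k, rfl⟩ := hdec y
    have hk : h ^ k ∉ F := fun hk ↦ hy (mul_mem (hNF hm) hk)
    have hfix : ∀ n ∈ commutator G, Commute n (h ^ k) → n = 1 :=
      fun n hn hc ↦ (hfree n hn _ hc).resolve_right hk
    let f : commutator G → commutator G := fun n ↦
      ⟨n * (h ^ k * (n : G)⁻¹ * (h ^ k)⁻¹), mul_mem n.2 (conj _ _ (inv_mem n.2))⟩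
    have hinj : Function.Injective f := fun a b hab ↦ by
      have hab : (a : G) * (h ^ k * (a : G)⁻¹ * (h ^ k)⁻¹) =
        b * (h ^ k * (b : G)⁻¹ * (h ^ k)⁻¹) := congrArg Subtype.val hab
      have h1 : (b : G)⁻¹ * a = 1 := by
        refine hfix _ (mul_mem (inv_mem b.2) a.2) ?_
        calc (b : G)⁻¹ * a * h ^ k
            = (b : G)⁻¹ * (a * (h ^ k * (a : G)⁻¹ * (h ^ k)⁻¹)) * h ^ k * a := by group
          _ = h ^ k * ((b : G)⁻¹ * a) := by rw [hab]; group
      exact Subtype.ext (inv_mul_eq_one.1 h1).symm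
    obtain ⟨n, hn⟩ := Finite.surjective_of_injective hinj ⟨m, hm⟩
    have hn : (n : G) * (h ^ k * (n : G)⁻¹ * (h ^ k)⁻¹) = m := congrArg Subtype.val hn
    refine ⟨n, Subgroup.ext fun x ↦ ?_⟩
    have hy' : m * h ^ k = n * h ^ k * (n : G)⁻¹ := by rw [← hn]; group
    have hx : (n : G) * ((n : G)⁻¹ * x * n) * (n : G)⁻¹ = x := by group
    rw [memc, mem, hy']
    nth_rw 1 [← hx]
    rw [Commute.conj_iff]
    refine ⟨fun hc ↦ ?_, fun hc ↦ hc.zpow_right k⟩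
    obtain ⟨a, ha, j, hj⟩ := hdec ((n : G)⁻¹ * x * n)
    rw [hj] at hc ⊢
    have hjk : Commute (h ^ j) (h ^ k) := ((Commute.refl h).zpow_left j).zpow_right k
    have ha1 : a = 1 := hfix a ha <| by
      have := hc.mul_left hjk.inv_left
      rwa [mul_inv_cancel_right] at this
    rw [ha1, one_mul]
    exact (Commute.refl h).zpow_left j
  have hinside : ∀ y ∈ F, Subgroup.centralizer {y} = ⊤ ∨ Subgroup.centralizer {y} = F :=
      fun y hy ↦ by
    obtain ⟨n, hn, k, rfl⟩ := hdec y
    have hk : h ^ k ∈ F := (F.mul_mem_cancel_left (hNF hn)).1 hy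
    by_cases hn1 : n = 1
    · refine .inl ((Subgroup.eq_top_iff' _).2 fun x ↦ mem.2 ?_)
      rw [hn1, one_mul]
      exact hcent k hk x
    · refine .inr (le_antisymm (fun x hx ↦ ?_) fun x hx ↦ mem.2 (hFcomm x hx _ hy))
      have h1 := (mem.1 hx).mul_right (hcent k hk x).inv_right
      rw [mul_inv_cancel_right] at h1
      exact (hfree n hn x h1.symm).resolve_left hn1
  have hhF : h ∉ F := fun hhF ↦ hn₀1 (hone n₀ hn₀ (hhF n₀ hn₀))
  have hCn₀ : Subgroup.centralizer {n₀} = F :=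
    (hinside n₀ (hNF hn₀)).resolve_left fun ht ↦
      hn₀1 (hone n₀ hn₀ (mem.1 (ht ▸ Subgroup.mem_top h : h ∈ Subgroup.centralizer {n₀})).symm)
  have hCent : Cent G = insert ⊤ (insert F (Set.range c)) := by
    ext H
    simp only [Cent, Set.mem_ofPred_eq, Set.mem_insert_iff, Set.mem_range]
    constructor
    · rintro ⟨y, rfl⟩
      by_cases hy : y ∈ F
      · exact (hinside y hy).imp_right .inl
      · obtain ⟨n, hn⟩ := houtside y hy
        exact .inr (.inr ⟨n, hn.symm⟩)
    · rintro (rfl | rfl | ⟨n, rfl⟩)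
      · exact ⟨1, ((Subgroup.eq_top_iff' _).2 fun x ↦ mem.2 (.one_right x)).symm⟩
      · exact ⟨n₀, hCn₀.symm⟩
      · exact ⟨_, rfl⟩
  have hcinj : Function.Injective c := fun a b hab ↦ by
    have h1 : a * h * (a : G)⁻¹ ∈ c b := hab ▸ mem.2 (.refl _)
    rw [memc] at h1
    set k : G := (b : G)⁻¹ * a with hk
    have hkN : k ∈ commutator G := mul_mem (inv_mem b.2) a.2
    have h2 : Commute (k * (h * k⁻¹ * h⁻¹)) h := by
      have h2 := h1.mul_left (Commute.refl h).inv_left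
      have : (b : G)⁻¹ * (a * h * (a : G)⁻¹) * b * h⁻¹ = k * (h * k⁻¹ * h⁻¹) := by rw [hk]; group
      rwa [this] at h2
    have h3 := hone _ (mul_mem hkN (conj h _ (inv_mem hkN))) h2
    have h4 : k = 1 := hone k hkN <| by
      calc k * h = k * (h * k⁻¹ * h⁻¹) * (h * k) := by group
        _ = h * k := by rw [h3, one_mul]
    exact Subtype.ext (inv_mul_eq_one.1 h4).symm
  rw [hCent, Set.ncard_insert_of_notMem, Set.ncard_insert_of_notMem,
    Set.ncard_range_of_injective hcinj]
  · rintro ⟨n, hn⟩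
    exact hn₀c n (hn ▸ hNF hn₀)
  · rintro (ht | ⟨n, hn⟩)
    · exact hhF (ht ▸ Subgroup.mem_top h)
    · exact hn₀c n (hn ▸ Subgroup.mem_top n₀)

open ArithmeticFunction in
theorem eq_one_or_prime_of_mul_eq_three_primes {a b p q r : ℕ} (hp : p.Prime) (hq : q.Prime)
    (hr : r.Prime) (h : a * b = p * q * r) : (a = 1 ∨ a.Prime) ∨ (b = 1 ∨ b.Prime) := by
  have h0 : a * b ≠ 0 := h ▸ mul_ne_zero (mul_ne_zero hp.ne_zero hq.ne_zero) hr.ne_zero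
  have ha := left_ne_zero_of_mul h0
  have hb := right_ne_zero_of_mul h0
  have hΩ := congrArg cardFactors h
  rw [cardFactors_mul ha hb, cardFactors_mul (mul_ne_zero hp.ne_zero hq.ne_zero) hr.ne_zero,
    cardFactors_mul hp.ne_zero hq.ne_zero, cardFactors_apply_prime hp, cardFactors_apply_prime hq,
    cardFactors_apply_prime hr] at hΩ
  have small : ∀ n : ℕ, n ≠ 0 → cardFactors n ≤ 1 → n = 1 ∨ n.Prime := fun n hn h1 ↦ by
    rcases Nat.le_one_iff_eq_zero_or_eq_one.1 h1 with h1 | h1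
    · exact .inl ((cardFactors_eq_zero_iff_eq_zero_or_one.1 h1).resolve_left hn)
    · exact .inr (cardFactors_eq_one_iff_prime.1 h1)
  by_cases h1 : cardFactors a ≤ 1
  · exact .inl (small a ha h1)
  · exact .inr (small b hb (by lia))

theorem card_cent_eq_card_commutator_add_two
    (G : Type*) [Group G] [Finite G] (p q r : ℕ)
    (hp : p.Prime) (hq : q.Prime) (hr : r.Prime)
    (hpq : p < q) (hqr : q < r)
    (hcard : Nat.card G = p * q * r)
    (hna : ¬ ∀ a b : G, a * b = b * a) :
    (Cent G).ncard = Nat.card (commutator G) + 2 := by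
  have hsq : Squarefree (Nat.card G) := by
    have h1 : p.Coprime q := (Nat.coprime_primes hp hq).2 hpq.ne
    have h2 : p.Coprime r := (Nat.coprime_primes hp hr).2 (hpq.trans hqr).ne
    have h3 : q.Coprime r := (Nat.coprime_primes hq hr).2 hqr.ne
    rw [hcard, Nat.squarefree_mul (h2.mul_left h3), Nat.squarefree_mul h1]
    exact ⟨⟨hp.prime.squarefree, hq.prime.squarefree⟩, hr.prime.squarefree⟩
  have : IsZGroup G := .of_squarefree hsq
  have : IsCyclic (commutator G) := IsZGroup.isCyclic_commutator G
  have hN : ∀ a ∈ commutator G, ∀ b ∈ commutator G, Commute a b := fun a ha b hb ↦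
    congrArg Subtype.val (IsCyclic.isMulCommutative.is_comm.comm (⟨a, ha⟩ : commutator G) ⟨b, hb⟩)
  obtain ⟨x, hx⟩ := (inferInstance : IsCyclic (Abelianization G)).exists_generator
  obtain ⟨h, rfl⟩ := QuotientGroup.mk_surjective x
  refine ncard_cent_of_commute_imp hN hx (fun n hn y hny ↦ ?_) ?_
  · by_cases hyN : y ∈ commutator G
    · exact .inr fun a ha ↦ hN a ha y hyN
    have hy1 : (y : G ⧸ commutator G) ≠ 1 := fun h1 ↦ hyN ((QuotientGroup.eq_one_iff y).1 h1)
    have hprod := ((commutator G).card_mul_index).trans hcard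
    rcases eq_one_or_prime_of_mul_eq_three_primes hp hq hr hprod with (h1 | h1) | (h1 | h1)
    · rw [Subgroup.card_eq_one] at h1
      exact .inl (Subgroup.mem_bot.1 (h1 ▸ hn))
    · refine or_iff_not_imp_left.2 fun hn1 a ha ↦ ?_
      have := Fact.mk h1
      obtain ⟨k, hk⟩ := mem_zpowers_of_prime_card (g := (⟨n, hn⟩ : commutator G))
        (g' := ⟨a, ha⟩) rfl (fun h ↦ hn1 (congrArg Subtype.val h))
      have hk : n ^ k = a := congrArg Subtype.val hk
      exact hk ▸ hny.zpow_left k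
    · rw [Subgroup.index_eq_one] at h1
      exact absurd (h1 ▸ Subgroup.mem_top y) hyN
    · have := Fact.mk h1
      exact .inl (eq_one_of_mem_commutator_of_commute hN
        (fun g ↦ mem_zpowers_of_prime_card (p := (commutator G).index) rfl hy1) hn hny)
  · by_contra! hc
    refine hna fun a b ↦ commutatorElement_eq_one_iff_mul_comm.1 (hc _ ?_)
    exact Subgroup.commutator_mem_commutator (Subgroup.mem_top a) (Subgroup.mem_top b)
end

section
/- If G is a finite non-abelian group of order pqr with p < q < r primes, then |Cent(G)| is one of q+2, r+2, or qr+2. -/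
open Subgroup in
/-- Suppose `D` is an abelian subgroup containing the commutator subgroup but not contained in the
center, such that every element of `G` either centralizes `D` or commutes with no nontrivial
element of `D`. Then `G` has exactly `|D| + 2` element centralizers. -/
theorem ncard_Cent_eq_card_add_two {G : Type*} [Group G] [Finite G] (D : Subgroup G)
    (hD : commutator G ≤ D) (hcomm : ∀ a ∈ D, ∀ b ∈ D, Commute a b)
    (hfix : ∀ g, ∀ d ∈ D, d ≠ 1 → Commute g d → ∀ e ∈ D, Commute g e)
    (hcenter : ¬ D ≤ center G) :
    (Cent G).ncard = Nat.card D + 2 := by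
  have hcD (a b : G) : a * b * a⁻¹ * b⁻¹ ∈ D :=
    hD (commutator_mem_commutator (mem_top a) (mem_top b))
  have hnormal : D.Normal := .of_commutator_le G hD
  have hmem (g : G) : g ∈ centralizer (D : Set G) ↔ ∀ e ∈ D, Commute g e := by
    simp only [mem_centralizer_iff, SetLike.mem_coe, commute_iff_eq, eq_comm]
  have hmem₁ (g x : G) : g ∈ centralizer {x} ↔ Commute g x := by
    simp only [mem_centralizer_singleton_iff, commute_iff_eq]
  set A := centralizer (D : Set G)
  have hDA : D ≤ A := fun d hd => (hmem d).2 (hcomm d hd)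
  have hfree {x d : G} (hx : x ∉ A) (hd : d ∈ D) (h : Commute x d) : d = 1 := by
    by_contra hd1
    exact hx ((hmem x).2 (hfix x d hd hd1 h))
  have habel {x a b : G} (hx : x ∉ A) (ha : Commute x a) (hb : Commute x b) : Commute a b := by
    have h := hfree hx (hcD a b)
      (((ha.mul_right hb).mul_right ha.inv_right).mul_right hb.inv_right)
    rwa [mul_inv_eq_one, mul_inv_eq_iff_eq_mul] at h
  have hconj {x d : G} (hx : x ∉ A) (hd : d ∈ D) : ∃ e ∈ D, e * x * e⁻¹ = x * d := by
    let f : D → D := fun e => ⟨x⁻¹ * e * x * e⁻¹, by simpa using hcD x⁻¹ e⟩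
    have hf : Function.Injective f := by
      intro a b hab
      have hab : x⁻¹ * (a : G) * x * (a : G)⁻¹ = x⁻¹ * b * x * (b : G)⁻¹ := congrArg Subtype.val hab
      have h : x * ((b : G)⁻¹ * a) = (b : G)⁻¹ * a * x := by
        have : (a : G) * x * (a : G)⁻¹ = b * x * (b : G)⁻¹ := by
          simpa [mul_assoc] using hab
        calc x * ((b : G)⁻¹ * a) = (b : G)⁻¹ * (b * x * (b : G)⁻¹) * a := by group
          _ = (b : G)⁻¹ * a * x := by rw [← this]; group
      exact Subtype.ext (inv_mul_eq_one.1
        (hfree hx (D.mul_mem (D.inv_mem b.2) a.2) h)).symm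
    obtain ⟨e, he⟩ := Finite.surjective_of_injective hf ⟨d, hd⟩
    refine ⟨e, e.2, ?_⟩
    have he : x⁻¹ * (e : G) * x * (e : G)⁻¹ = d := congrArg Subtype.val he
    rw [← he]; group
  have hfactor {x : G} (hx : x ∉ A) (g : G) : ∃ h, Commute x h ∧ ∃ d ∈ D, g = h * d := by
    obtain ⟨e, he, hex⟩ := hconj hx (d := x⁻¹ * g * x * g⁻¹) (by simpa using hcD x⁻¹ g)
    have hex : e * x * e⁻¹ = g * x * g⁻¹ := by rw [hex]; group
    refine ⟨e⁻¹ * g, ?_, (e⁻¹ * g)⁻¹ * e * (e⁻¹ * g), ?_, by group⟩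
    · calc x * (e⁻¹ * g) = e⁻¹ * (e * x * e⁻¹) * g := by group
        _ = e⁻¹ * g * x := by rw [hex]; group
    · simpa using hnormal.conj_mem e he (e⁻¹ * g)⁻¹
  obtain ⟨x, hx⟩ : ∃ x, x ∉ A := by
    by_contra! h
    refine hcenter fun d hd => mem_center_iff.2 fun g => ?_
    exact (hmem g).1 (h g) d hd
  obtain ⟨d₀, hd₀, hd₀1⟩ : ∃ d ∈ D, d ≠ 1 := by
    by_contra! h
    exact hcenter fun d hd => h d hd ▸ one_mem _
  have hAfactor {a : G} (ha : a ∈ A) : ∃ z ∈ center G, ∃ d ∈ D, a = z * d := by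
    obtain ⟨h, hxh, d, hd, rfl⟩ := hfactor hx a
    have hh : h ∈ A := (A.mul_mem_cancel_right (hDA hd)).1 ha
    refine ⟨h, mem_center_iff.2 fun g => ?_, d, hd, rfl⟩
    obtain ⟨k, hxk, e, he, rfl⟩ := hfactor hx g
    exact (((habel hx hxh hxk).mul_right ((hmem h).1 hh e he))).symm
  have hcentA {d : G} (hd : d ∈ D) (hd1 : d ≠ 1) : centralizer {d} = A := by
    ext g
    rw [hmem₁, hmem]
    exact ⟨hfix g d hd hd1, fun h => h d hd⟩
  have hcentMul {z : G} (hz : z ∈ center G) (d : G) : centralizer {z * d} = centralizer {d} := by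
    ext g
    have hzg : Commute g z := mem_center_iff.1 hz g
    rw [hmem₁, hmem₁]
    refine ⟨fun h => ?_, hzg.mul_right⟩
    simpa using hzg.inv_right.mul_right h
  have hconjA {y : G} (hy : y ∉ A) (g : G) : g * y * g⁻¹ ∉ A := fun h =>
    hy (by simpa [mul_assoc] using (inferInstance : A.Normal).conj_mem _ h g⁻¹)
  let F : D → Subgroup G := fun d => centralizer {(d : G) * x * (d : G)⁻¹}
  have hF : Function.Injective F := by
    intro a b hab
    have h1 : Commute ((a : G) * x * (a : G)⁻¹) (b * x * (b : G)⁻¹) := by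
      rw [← hmem₁]
      change _ ∈ F b
      rw [← hab, hmem₁]
    have h2 : (b : G) * x * (b : G)⁻¹ * ((a : G) * x * (a : G)⁻¹)⁻¹ = 1 := by
      refine hfree (hconjA hx a) ?_ (h1.mul_right (Commute.refl _).inv_right)
      have := hcD ((b : G) * (a : G)⁻¹) (a * x * (a : G)⁻¹)
      have e : (b : G) * x * (b : G)⁻¹ * ((a : G) * x * (a : G)⁻¹)⁻¹ =
        (b : G) * (a : G)⁻¹ * (a * x * (a : G)⁻¹) * ((b : G) * (a : G)⁻¹)⁻¹ *
          (a * x * (a : G)⁻¹)⁻¹ := by group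
      rwa [e]
    rw [mul_inv_eq_one] at h2
    have h3 : Commute x ((b : G)⁻¹ * a) := by
      calc x * ((b : G)⁻¹ * a) = (b : G)⁻¹ * (b * x * (b : G)⁻¹) * a := by group
        _ = (b : G)⁻¹ * a * x := by rw [h2]; group
    exact Subtype.ext (inv_mul_eq_one.1 (hfree hx (D.mul_mem (D.inv_mem b.2) a.2) h3)).symm
  have hrange {y : G} (hy : y ∉ A) : centralizer {y} ∈ Set.range F := by
    obtain ⟨h, hxh, d, hd, rfl⟩ := hfactor hx y
    have hh : h ∉ A := fun hh => hy (A.mul_mem hh (hDA hd))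
    obtain ⟨e, he, hed⟩ := hconj hh hd
    refine ⟨⟨e, he⟩, ?_⟩
    have hconj_iff (g t : G) : Commute g (e * t * e⁻¹) ↔ Commute (e⁻¹ * g * e) t := by
      rw [← Commute.conj_iff e (a := e⁻¹ * g * e)]
      simp [mul_assoc]
    ext g
    rw [← hed, hmem₁, hmem₁, hconj_iff, hconj_iff]
    exact ⟨fun hg => habel hx hg.symm hxh, fun hg => habel hh hg.symm hxh.symm⟩
  have hCent : Cent G = insert ⊤ (insert A (Set.range F)) := by
    ext H
    rw [Cent, Set.mem_ofPred_eq]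
    simp only [Set.mem_insert_iff]
    constructor
    · rintro ⟨y, rfl⟩
      by_cases hy : y ∈ A
      · obtain ⟨z, hz, d, hd, rfl⟩ := hAfactor hy
        rw [hcentMul hz]
        by_cases hd1 : d = 1
        · left
          rw [eq_top_iff]
          intro g _
          rw [hmem₁, hd1]
          exact Commute.one_right g
        · exact Or.inr (Or.inl (hcentA hd hd1))
      · exact Or.inr (Or.inr (hrange hy))
    · rintro (rfl | rfl | ⟨d, rfl⟩)
      · refine ⟨1, (eq_top_iff.2 fun g _ => ?_).symm⟩
        rw [hmem₁]
        exact Commute.one_right g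
      · exact ⟨d₀, (hcentA hd₀ hd₀1).symm⟩
      · exact ⟨_, rfl⟩
  have hArange : A ∉ Set.range F := by
    rintro ⟨d, hd⟩
    refine hconjA hx d (hd ▸ ?_)
    exact (hmem₁ _ _).2 (Commute.refl _)
  have htop : ⊤ ∉ insert A (Set.range F) := by
    rintro (h | ⟨d, hd⟩)
    · exact hx (h ▸ mem_top x)
    · have : d₀ ∈ F d := hd ▸ mem_top d₀
      exact hd₀1 (hfree (hconjA hx d) hd₀ ((hmem₁ _ _).1 this).symm)
  rw [hCent, Set.ncard_insert_of_notMem htop, Set.ncard_insert_of_notMem hArange,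
    Set.ncard_range_of_injective hF]

/-- A homomorphism to a commutative group is trivial on the commutator subgroup. -/
theorem commutator_le_ker_of_isMulCommutative {G H : Type*} [Group G] [Group H]
    [IsMulCommutative H] (f : G →* H) : commutator G ≤ f.ker := by
  rw [commutator_def, Subgroup.commutator_le]
  intro a _ b _
  rw [MonoidHom.mem_ker, map_commutatorElement, commutatorElement_eq_one_iff_mul_comm]
  exact mul_comm' _ _

/-- In a finite group of squarefree order, the commutator subgroup meets the center trivially. -/
theorem commutator_inf_center_eq_bot_of_squarefree {G : Type*} [Group G] [Finite G]
    (h : Squarefree (Nat.card G)) : commutator G ⊓ Subgroup.center G = ⊥ := by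
  rw [eq_bot_iff]
  rintro z ⟨hzD, hzZ⟩
  have hpow : z ^ (Subgroup.center G).index = 1 :=
    congrArg (Subtype.val : Subgroup.center G → G) (MonoidHom.mem_ker.1
      (commutator_le_ker_of_isMulCommutative (MonoidHom.transferCenterPow G) hzD))
  have hdvd : orderOf z ∣ Nat.card (Subgroup.center G) := Subgroup.orderOf_dvd_natCard _ hzZ
  rw [← (Subgroup.center G).card_mul_index] at h
  have hone := Nat.eq_one_of_dvd_coprimes (Nat.coprime_of_squarefree_mul h) hdvd
    (orderOf_dvd_of_pow_eq_one hpow)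
  exact Subgroup.mem_bot.2 (orderOf_eq_one_iff.1 hone)

/-- If all Sylow subgroups of a finite group are cyclic, then the smallest prime divisor of its
order does not divide the order of the commutator subgroup. -/
theorem minFac_not_dvd_card_commutator {G : Type*} [Group G] [Finite G] [IsZGroup G]
    [Nontrivial G] : ¬ (Nat.card G).minFac ∣ Nat.card (commutator G) := by
  have := Fact.mk (Nat.minFac_prime (Finite.one_lt_card (α := G)).ne')
  let P : Sylow (Nat.card G).minFac G := default
  have hP : IsCyclic P := inferInstance
  have hPC := hP.normalizer_le_centralizer rfl
  have hcomm : IsMulCommutative P := hP.isMulCommutative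
  have hle : commutator G ≤ (MonoidHom.transferSylow P hPC).ker :=
    commutator_le_ker_of_isMulCommutative _
  exact fun h => MonoidHom.not_dvd_card_ker_transferSylow P hPC
    (h.trans (Subgroup.card_dvd_of_le hle))

theorem card_cent_of_order_pqr
    (G : Type*) [Group G] [Finite G] (p q r : ℕ)
    (hp : p.Prime) (hq : q.Prime) (hr : r.Prime)
    (hpq : p < q) (hqr : q < r)
    (hcard : Nat.card G = p * q * r)
    (hna : ¬ ∀ a b : G, a * b = b * a) :
    (Cent G).ncard = q + 2 ∨ (Cent G).ncard = r + 2 ∨ (Cent G).ncard = q * r + 2 := by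
  have hcop_pq : p.Coprime q := (Nat.coprime_primes hp hq).2 hpq.ne
  have hcop_pr : p.Coprime r := (Nat.coprime_primes hp hr).2 (hpq.trans hqr).ne
  have hcop_qr : q.Coprime r := (Nat.coprime_primes hq hr).2 hqr.ne
  have hsq : Squarefree (Nat.card G) := by
    rw [hcard, Nat.squarefree_mul (hcop_pr.mul_left hcop_qr), Nat.squarefree_mul hcop_pq]
    exact ⟨⟨hp.prime.squarefree, hq.prime.squarefree⟩, hr.prime.squarefree⟩
  have : IsZGroup G := .of_squarefree hsq
  have : Nontrivial G := by
    by_contra h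
    rw [not_nontrivial_iff_subsingleton] at h
    exact hna fun _ _ => Subsingleton.elim _ _
  have hmin : (Nat.card G).minFac = p := by
    refine le_antisymm (Nat.minFac_le_of_dvd hp.two_le ⟨q * r, by rw [hcard, mul_assoc]⟩) ?_
    have hprime := Nat.minFac_prime (Finite.one_lt_card (α := G)).ne'
    have hdvd := Nat.minFac_dvd (Nat.card G)
    rw [hcard] at hdvd hprime ⊢
    rcases (hprime.dvd_mul.1 hdvd) with h | h
    · rcases (hprime.dvd_mul.1 h) with h | h
      · exact ((Nat.prime_dvd_prime_iff_eq hprime hp).1 h).ge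
      · exact hpq.le.trans ((Nat.prime_dvd_prime_iff_eq hprime hq).1 h).ge
    · exact (hpq.trans hqr).le.trans ((Nat.prime_dvd_prime_iff_eq hprime hr).1 h).ge
  set D := commutator G with hD
  have hpD : ¬ p ∣ Nat.card D := hmin ▸ minFac_not_dvd_card_commutator
  have hinf : D ⊓ Subgroup.center G = ⊥ := commutator_inf_center_eq_bot_of_squarefree hsq
  have hD1 : Nat.card D ≠ 1 := fun h => hna fun a b => by
    have hmem : a * b * a⁻¹ * b⁻¹ ∈ D :=
      Subgroup.commutator_mem_commutator (Subgroup.mem_top a) (Subgroup.mem_top b)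
    rw [Subgroup.card_eq_one.1 h, Subgroup.mem_bot] at hmem
    rwa [mul_inv_eq_one, mul_inv_eq_iff_eq_mul] at hmem
  have hcenter : ¬ D ≤ Subgroup.center G := fun h =>
    hD1 (Subgroup.card_eq_one.2 (by rwa [inf_eq_left.2 h] at hinf))
  have hcyc : IsCyclic D := IsZGroup.isCyclic_commutator G
  have hcomm : ∀ a ∈ D, ∀ b ∈ D, Commute a b := fun a ha b hb =>
    congrArg Subtype.val (hcyc.isMulCommutative.is_comm.comm (⟨a, ha⟩ : D) ⟨b, hb⟩)
  have hdvd : Nat.card D ∣ q * r := by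
    have h := D.card_subgroup_dvd_card
    rw [hcard, mul_assoc] at h
    exact ((hp.coprime_iff_not_dvd.2 hpD).symm).dvd_of_dvd_mul_left h
  have hDcases : Nat.card D = q ∨ Nat.card D = r ∨ Nat.card D = q * r := by
    obtain ⟨a, b, ha, hb, hab⟩ := exists_dvd_and_dvd_of_dvd_mul hdvd
    rw [hab] at hD1 ⊢
    rcases (Nat.dvd_prime hq).1 ha with rfl | rfl <;>
      rcases (Nat.dvd_prime hr).1 hb with rfl | rfl <;> simp_all
  have hfix_prime (h : (Nat.card D).Prime) (g d : G) (hd : d ∈ D) (hd1 : d ≠ 1)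
      (hgd : Commute g d) (e : G) (he : e ∈ D) : Commute g e := by
    have := Fact.mk h
    obtain ⟨n, hn⟩ := Subgroup.mem_zpowers_iff.1 (mem_zpowers_of_prime_card (G := D) rfl
      (g := ⟨d, hd⟩) (g' := ⟨e, he⟩) (by simpa [Subtype.ext_iff] using hd1))
    have hn : d ^ n = e := congrArg Subtype.val hn
    exact hn ▸ hgd.zpow_right n
  have hfix_index (h : D.index.Prime) (g d : G) (hd : d ∈ D) (hd1 : d ≠ 1)
      (hgd : Commute g d) (e : G) (he : e ∈ D) : Commute g e := by
    have hle : D ≤ Subgroup.centralizer {d} := fun a ha =>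
      Subgroup.mem_centralizer_singleton_iff.2 (hcomm a ha d hd)
    by_cases hg : g ∈ D
    · exact hcomm g hg e he
    have hg' : g ∈ Subgroup.centralizer {d} := Subgroup.mem_centralizer_singleton_iff.2 hgd
    refine absurd ?_ hd1
    rw [← Subgroup.mem_bot, ← hinf]
    refine ⟨hd, Subgroup.mem_center_iff.2 fun a => ?_⟩
    have htop : Subgroup.centralizer {d} = ⊤ := by
      rw [← Subgroup.index_eq_one]
      have hmul := Subgroup.relIndex_mul_index hle
      rcases (Nat.prime_mul_iff.1 (hmul ▸ h)) with h | h
      · exact h.2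
      · exact absurd (Subgroup.relIndex_eq_one.1 h.2 hg') hg
    exact Subgroup.mem_centralizer_singleton_iff.1 (htop ▸ Subgroup.mem_top a)
  have hfix : ∀ g, ∀ d ∈ D, d ≠ 1 → Commute g d → ∀ e ∈ D, Commute g e := by
    rcases hDcases with h | h | h
    · exact hfix_prime (h ▸ hq)
    · exact hfix_prime (h ▸ hr)
    · refine hfix_index ?_
      have hmul := D.card_mul_index
      rw [h, hcard, mul_assoc p, mul_comm p] at hmul
      rwa [Nat.eq_of_mul_eq_mul_left (Nat.mul_pos hq.pos hr.pos) hmul]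
  rw [ncard_Cent_eq_card_add_two D hD.ge hcomm hfix hcenter]
  rcases hDcases with h | h | h <;> simp [h]
end

section
/- If G is a finite group with |G/Z(G)| = pqr, where p < q < r are primes, then |Cent(G)| equals r+2 or qr+2. -/
open Subgroup in
/-- If two elements of `G` commute modulo the center and `G ⧸ Z(G)` has squarefree order,
then they commute. -/
theorem commute_of_commute_mk_center {G : Type*} [Group G] [Finite G]
    (hsq : Squarefree (Nat.card (G ⧸ center G))) {x y : G}
    (hxy : Commute (x : G ⧸ center G) (y : G ⧸ center G)) : Commute x y := by
  have hZ : IsZGroup (G ⧸ center G) := .of_squarefree hsq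
  let A : Subgroup (G ⧸ center G) := closure {(x : G ⧸ center G), (y : G ⧸ center G)}
  have hA : IsMulCommutative A := isMulCommutative_closure (by
    rintro a (rfl | rfl) b (rfl | rfl)
    exacts [rfl, hxy, hxy.symm, rfl])
  let _ : CommGroup A := { (inferInstance : Group A) with mul_comm := hA.is_comm.comm }
  have hcyc : IsCyclic A := inferInstance
  let B : Subgroup G := A.comap (QuotientGroup.mk' (center G))
  let f : B →* A := (QuotientGroup.mk' (center G)).subgroupComap A
  have hf : f.ker ≤ center B := by
    intro b hb
    have hb' : (QuotientGroup.mk' (center G)) (b : G) = 1 := congrArg Subtype.val hb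
    rw [← MonoidHom.mem_ker, QuotientGroup.ker_mk', mem_center_iff] at hb'
    exact mem_center_iff.2 fun g => Subtype.ext (hb' g)
  have hx : x ∈ B := subset_closure (Set.mem_insert _ _)
  have hy : y ∈ B := subset_closure (Set.mem_insert_of_mem _ rfl)
  have hB := f.isMulCommutative_of_isCyclic_of_ker_le_center hf
  exact congrArg Subtype.val (hB.is_comm.comm ⟨x, hx⟩ ⟨y, hy⟩)

open Subgroup in
theorem center_quotient_center_eq_bot {G : Type*} [Group G] [Finite G]
    (hsq : Squarefree (Nat.card (G ⧸ center G))) : center (G ⧸ center G) = ⊥ := by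
  rw [eq_bot_iff]
  intro z
  induction z using QuotientGroup.induction_on with
  | H x =>
    intro hx
    rw [mem_bot, QuotientGroup.eq_one_iff, mem_center_iff]
    exact fun g => commute_of_commute_mk_center hsq (mem_center_iff.1 hx g)

open Subgroup in
theorem ncard_Cent_quotient_center {G : Type*} [Group G] [Finite G]
    (hsq : Squarefree (Nat.card (G ⧸ center G))) :
    (Cent G).ncard = (Cent (G ⧸ center G)).ncard := by
  have hcomap (x : G) : (centralizer {(x : G ⧸ center G)}).comap (QuotientGroup.mk' (center G)) =
      centralizer {x} := by
    ext g
    simp only [mem_comap, mem_centralizer_singleton_iff]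
    exact ⟨fun h => commute_of_commute_mk_center hsq h,
      fun h => congrArg (QuotientGroup.mk' (center G)) h⟩
  have himage : Cent G = comap (QuotientGroup.mk' (center G)) '' Cent (G ⧸ center G) := by
    ext H
    constructor
    · rintro ⟨x, rfl⟩
      exact ⟨_, ⟨x, rfl⟩, hcomap x⟩
    · rintro ⟨_, ⟨y, rfl⟩, rfl⟩
      obtain ⟨x, rfl⟩ := QuotientGroup.mk_surjective y
      exact ⟨x, hcomap x⟩
  rw [himage, Set.ncard_image_of_injective _
    (comap_injective (QuotientGroup.mk'_surjective (center G)))]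

open Subgroup in
/-- Number of element centralizers of a Frobenius group with cyclic quotient `Q ⧸ K` by its
abelian kernel `K`. -/
theorem ncard_Cent_of_centralizer_eq {Q : Type*} [Group Q] [Finite Q] (K : Subgroup Q) [K.Normal]
    [IsCyclic (Q ⧸ K)] (hbot : K ≠ ⊥) (htop : K ≠ ⊤)
    (hK : ∀ k ∈ K, k ≠ 1 → centralizer {k} = K) : (Cent Q).ncard = Nat.card K + 2 := by
  have hdisj {x k : Q} (hx : x ∉ K) (hk : k ∈ K) (hxk : Commute x k) : k = 1 := by
    by_contra hne
    rw [← hK k hk hne, mem_centralizer_singleton_iff] at hx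
    exact hx hxk
  obtain ⟨g, hg⟩ := IsCyclic.exists_generator (α := Q ⧸ K)
  obtain ⟨a, rfl⟩ := QuotientGroup.mk_surjective g
  have hpow (x : Q) : ∃ j : ℤ, x * (a ^ j)⁻¹ ∈ K := by
    obtain ⟨j, hj⟩ := hg x
    refine ⟨j, ?_⟩
    rw [← QuotientGroup.eq_one_iff, QuotientGroup.mk_mul, QuotientGroup.mk_inv,
      QuotientGroup.mk_zpow]
    simp only at hj
    rw [hj, mul_inv_cancel]
  have ha : a ∉ K := by
    intro ha
    refine htop (eq_top_iff.2 fun x _ => ?_)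
    obtain ⟨j, hj⟩ := hpow x
    simpa using K.mul_mem hj (K.zpow_mem ha j)
  have hcomm (x y : Q) : x * y * x⁻¹ * y⁻¹ ∈ K := by
    obtain ⟨m, hm⟩ := hg x
    obtain ⟨n, hn⟩ := hg y
    simp only at hm hn
    rw [← QuotientGroup.eq_one_iff, QuotientGroup.mk_mul, QuotientGroup.mk_mul,
      QuotientGroup.mk_mul, QuotientGroup.mk_inv, QuotientGroup.mk_inv, ← hm, ← hn,
      ((Commute.refl (a : Q ⧸ K)).zpow_zpow m n).eq]
    simp
  have hconj {x z : Q} (hz : z ∉ K) (hx : x * z⁻¹ ∈ K) : ∃ k ∈ K, k * z * k⁻¹ = x := by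
    let f : K → K := fun k => ⟨k * z * (k : Q)⁻¹ * z⁻¹, hcomm k z⟩
    have hf : Function.Injective f := by
      intro k l hkl
      have h1 : (k : Q) * z * (k : Q)⁻¹ = l * z * (l : Q)⁻¹ :=
        mul_right_cancel (congrArg Subtype.val hkl)
      have h2 : (l : Q)⁻¹ * k = 1 := by
        refine hdisj hz (K.mul_mem (K.inv_mem l.2) k.2) ?_
        have h3 : (l : Q)⁻¹ * (k * z * (k : Q)⁻¹) * k = (l : Q)⁻¹ * (l * z * (l : Q)⁻¹) * k := by
          rw [h1]
        change z * ((l : Q)⁻¹ * k) = (l : Q)⁻¹ * k * z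
        simpa [mul_assoc] using h3.symm
      exact Subtype.ext (inv_mul_eq_one.1 h2).symm
    obtain ⟨k, hk⟩ := Finite.surjective_of_injective hf ⟨_, hx⟩
    exact ⟨k, k.2, mul_right_cancel (congrArg Subtype.val hk)⟩
  have hnot {y : Q} (hy : y ∈ (a * ·) '' (K : Set Q)) : y ∉ K := by
    obtain ⟨k, hk, rfl⟩ := hy
    exact fun h => ha ((K.mul_mem_cancel_right hk).1 h)
  have hCent : Cent Q = insert ⊤ (insert K
      ((fun y => centralizer {y}) '' ((a * ·) '' (K : Set Q)))) := by
    ext H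
    simp only [Set.mem_insert_iff]
    constructor
    · rintro ⟨x, rfl⟩
      by_cases hx1 : x = 1
      · left
        simp [hx1, centralizer_eq_top_iff_subset]
      right
      by_cases hx : x ∈ K
      · exact .inl (hK x hx hx1)
      right
      obtain ⟨j, hj⟩ := hpow x
      have hz : a ^ j ∉ K := fun h => hx (by simpa using K.mul_mem hj h)
      obtain ⟨k, hk, rfl⟩ := hconj hz hj
      refine ⟨k * a * k⁻¹, ⟨a⁻¹ * (k * a * k⁻¹), ?_, by simp⟩, ?_⟩
      · have h1 := K.mul_mem (Normal.conj_mem ‹_› k hk a⁻¹) (K.inv_mem hk)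
        simpa [mul_assoc] using h1
      · have hyx : Commute (k * a * k⁻¹) (k * a ^ j * k⁻¹) := by
          rw [← conj_zpow]
          exact (Commute.refl _).zpow_right j
        apply le_antisymm
        · intro g hg
          rw [mem_centralizer_singleton_iff] at hg ⊢
          rw [← conj_zpow]
          exact Commute.zpow_right hg j
        · intro g hg
          rw [mem_centralizer_singleton_iff] at hg ⊢
          have h1 := hdisj hx (hcomm g (k * a * k⁻¹))
            (((Commute.mul_right (Commute.mul_right (Commute.symm hg) hyx.symm)
              (Commute.symm hg).inv_right)).mul_right hyx.symm.inv_right)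
          rw [mul_inv_eq_one, mul_inv_eq_iff_eq_mul] at h1
          exact h1
    · rintro (rfl | hH | ⟨y, -, rfl⟩)
      · exact ⟨1, by simp [eq_comm, centralizer_eq_top_iff_subset]⟩
      · obtain ⟨k, hk, hne⟩ := K.bot_or_exists_ne_one.resolve_left hbot
        exact ⟨k, hH.trans (hK k hk hne).symm⟩
      · exact ⟨y, rfl⟩
  have hinj : Set.InjOn (fun y : Q => centralizer {y}) ((a * ·) '' (K : Set Q)) := by
    intro y hy z hz hyz
    have hyK := hnot hy
    obtain ⟨k, hk, rfl⟩ := hy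
    obtain ⟨l, hl, rfl⟩ := hz
    have hmem : a * l ∈ centralizer {a * k} := by
      simp only at hyz
      rw [hyz, mem_centralizer_singleton_iff]
    rw [mem_centralizer_singleton_iff] at hmem
    have h1 : (a * k)⁻¹ * (a * l) = 1 := by
      refine hdisj hyK ?_ ((Commute.refl _).inv_right.mul_right (Commute.symm hmem))
      simpa [mul_assoc] using K.mul_mem (K.inv_mem hk) hl
    exact inv_mul_eq_one.1 h1
  have hnotmem {y : Q} (hy : y ∉ K) : ¬ K ≤ centralizer {y} := by
    intro hle
    obtain ⟨k, hk, hne⟩ := K.bot_or_exists_ne_one.resolve_left hbot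
    exact hne (hdisj hy hk (mem_centralizer_singleton_iff.1 (hle hk)).symm)
  rw [hCent, Set.ncard_insert_of_notMem, Set.ncard_insert_of_notMem, hinj.ncard_image,
    Set.ncard_image_of_injective _ (mul_right_injective a)]
  · rfl
  · rintro ⟨y, hy, h⟩
    exact hnotmem (hnot hy) h.ge
  · rw [Set.mem_insert_iff, not_or]
    refine ⟨htop.symm, ?_⟩
    rintro ⟨y, hy, h⟩
    simp only at h
    exact hnotmem (hnot hy) (h ▸ le_top)

open Subgroup in
/-- If every nontrivial element of the cyclic normal subgroup `K` has centralizer `K`, then the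
index of `K` is smaller than every prime divisor of the order of `K`. -/
theorem index_lt_of_centralizer_eq {Q : Type*} [Group Q] [Finite Q] (K : Subgroup Q) [K.Normal]
    [IsCyclic K] (hK : ∀ k ∈ K, k ≠ 1 → centralizer {k} = K) {t : ℕ} (ht : t.Prime)
    (htK : t ∣ Nat.card K) : K.index < t := by
  classical
  have := Fact.mk ht
  obtain ⟨k, hk⟩ := exists_prime_orderOf_dvd_card' t htK
  have hne : (k : Q) ≠ 1 := by
    intro h
    rw [← orderOf_coe, h, orderOf_one] at hk
    exact ht.ne_one hk.symm
  have hkt : (k : Q) ^ t = 1 := by rw [← hk, ← orderOf_coe, pow_orderOf_eq_one]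
  have hroots : Nat.card {x : K | x ^ t = 1} ≤ t := by
    have := Fintype.ofFinite K
    rw [Nat.card_eq_fintype_card, Fintype.card_subtype]
    exact IsCyclic.card_pow_eq_one_le ht.pos
  let f : Option (Q ⧸ K) → {x : K | x ^ t = 1} := fun o => o.elim ⟨1, one_pow t⟩ fun c =>
    ⟨⟨c.out * k * c.out⁻¹, Normal.conj_mem ‹_› _ k.2 _⟩, Subtype.ext (by simp [conj_pow, hkt])⟩
  have hf : Function.Injective f := by
    have hval {c : Q ⧸ K} {o : Option (Q ⧸ K)} (h : f (some c) = f o) :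
        c.out * k * c.out⁻¹ = ((f o : K) : Q) :=
      congrArg (fun x : {x : K | x ^ t = 1} => ((x : K) : Q)) h
    have hnone {c : Q ⧸ K} (h : f (some c) = f none) : False :=
      hne (conj_eq_one_iff.1 (hval h))
    rintro (_ | c) (_ | d) h
    · rfl
    · exact (hnone h.symm).elim
    · exact (hnone h).elim
    · have h1 : c.out * k * c.out⁻¹ = d.out * (k : Q) * d.out⁻¹ := hval h
      have h2 : d.out⁻¹ * c.out ∈ K := by
        refine (hK k k.2 hne).le (mem_centralizer_singleton_iff.2 ?_)
        have h3 : d.out⁻¹ * (c.out * k * c.out⁻¹) * c.out =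
          d.out⁻¹ * (d.out * (k : Q) * d.out⁻¹) * c.out := by rw [h1]
        simpa [mul_assoc] using h3
      rw [← QuotientGroup.eq, QuotientGroup.out_eq', QuotientGroup.out_eq'] at h2
      rw [h2]
  have hcard := (Nat.card_le_card_of_injective f hf).trans hroots
  rw [Finite.card_option] at hcard
  exact hcard

theorem eq_or_eq_mul_of_mul_eq_of_lt_prime {p q r m n : ℕ} (hp : p.Prime) (hq : q.Prime)
    (hr : r.Prime) (hpq : p < q) (hqr : q < r) (hmn : m * n = p * q * r) (hm : m ≠ 1) (hn : n ≠ 1)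
    (hlt : ∀ t : ℕ, t.Prime → t ∣ m → n < t) : m = r ∨ m = q * r := by
  have hn0 : 0 < n := Nat.pos_of_ne_zero (by
    rintro rfl
    simp [hp.ne_zero, hq.ne_zero, hr.ne_zero] at hmn)
  have hpm : ¬ p ∣ m := by
    intro hpm
    have h1 := hlt p hp hpm
    have h2 : n.minFac ∣ p * q * r := (Nat.minFac_dvd n).trans (hmn ▸ dvd_mul_left n m)
    have h3 := Nat.minFac_le hn0
    have h4 := Nat.minFac_prime hn
    rcases h4.dvd_mul.1 h2 with h5 | h5
    · rcases h4.dvd_mul.1 h5 with h6 | h6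
      · rw [Nat.prime_dvd_prime_iff_eq h4 hp] at h6; omega
      · rw [Nat.prime_dvd_prime_iff_eq h4 hq] at h6; omega
    · rw [Nat.prime_dvd_prime_iff_eq h4 hr] at h5; omega
  obtain ⟨n', rfl⟩ : p ∣ n := (hp.dvd_mul.1 (hmn ▸ ⟨q * r, by ring⟩)).resolve_left hpm
  have hmn' : m * n' = q * r := Nat.eq_of_mul_eq_mul_left hp.pos (by linarith)
  by_cases hqm : q ∣ m
  · right
    have h1 := hlt q hq hqm
    have hrn : ¬ r ∣ n' := fun h => by
      have h2 := Nat.le_of_dvd hn0 (h.trans (dvd_mul_left n' p))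
      omega
    have hqn : ¬ q ∣ n' := fun h => by
      have h2 := Nat.le_of_dvd hn0 (h.trans (dvd_mul_left n' p))
      omega
    have hcop : Nat.Coprime (q * r) n' :=
      Nat.Coprime.mul_left (hq.coprime_iff_not_dvd.2 hqn) (hr.coprime_iff_not_dvd.2 hrn)
    exact Nat.dvd_antisymm (hmn' ▸ dvd_mul_right m n')
      (hcop.dvd_of_dvd_mul_right (hmn' ▸ dvd_rfl))
  · left
    have h1 : m ∣ r := (hq.coprime_iff_not_dvd.2 hqm).symm.dvd_of_dvd_mul_left
      (hmn' ▸ dvd_mul_right m n')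
    exact ((Nat.dvd_prime hr).1 h1).resolve_left hm

open Subgroup in
/-- In a centerless group, a self-centralizing subgroup of prime order or prime index is the
centralizer of each of its nontrivial elements. -/
theorem centralizer_singleton_eq_of_prime {Q : Type*} [Group Q] [Finite Q] (K : Subgroup Q)
    (hself : centralizer K = K) (hcenter : center Q = ⊥)
    (hprime : (Nat.card K).Prime ∨ K.index.Prime) {k : Q} (hk : k ∈ K) (hne : k ≠ 1) :
    centralizer {k} = K := by
  have hle : K ≤ centralizer {k} := by
    conv_lhs => rw [← hself]
    exact centralizer_le (Set.singleton_subset_iff.2 hk)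
  rcases hprime with hprime | hprime
  · have hz : zpowers k = K := by
      have := Fact.mk hprime
      have hzk : zpowers k ≤ K := zpowers_le.2 hk
      refine eq_of_le_of_card_ge hzk (Nat.le_of_dvd Nat.card_pos ?_)
      rcases (Nat.dvd_prime hprime).1 (card_dvd_of_le hzk) with h | h
      · rw [card_eq_one, zpowers_eq_bot] at h
        exact (hne h).elim
      · rw [h]
    conv_rhs => rw [← hself, ← hz, zpowers_eq_closure, centralizer_closure]
  · have h1 := relIndex_mul_index hle
    rcases (Nat.dvd_prime hprime).1 (Dvd.intro_left _ h1) with h | h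
    · rw [index_eq_one, centralizer_eq_top_iff_subset, Set.singleton_subset_iff, hcenter] at h
      exact (hne h).elim
    · rw [h] at h1
      refine le_antisymm (relIndex_eq_one.1 ?_) hle
      exact Nat.eq_of_mul_eq_mul_right hprime.pos (by simpa using h1)

open Subgroup in
theorem isMulCommutative_centralizer_commutator {Q : Type*} [Group Q] [Finite Q] [IsZGroup Q] :
    IsMulCommutative (centralizer (commutator Q : Set Q)) := by
  refine (Abelianization.of.comp
    (centralizer (commutator Q : Set Q)).subtype).isMulCommutative_of_isCyclic_of_ker_le_center ?_
  intro x hx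
  rw [MonoidHom.mem_ker, MonoidHom.comp_apply, ← MonoidHom.mem_ker, Abelianization.ker_of] at hx
  exact mem_center_iff.2 fun g => Subtype.ext (mem_centralizer_iff.1 g.2 _ hx).symm

open Subgroup in
theorem centralizer_centralizer_commutator {Q : Type*} [Group Q] [Finite Q] [IsZGroup Q] :
    centralizer (centralizer (commutator Q : Set Q) : Set Q) =
      centralizer (commutator Q : Set Q) := by
  have hcyc : IsCyclic (commutator Q) := IsZGroup.isCyclic_commutator Q
  apply le_antisymm
  · exact centralizer_le (le_centralizer (commutator Q))
  · exact le_centralizer_iff_isMulCommutative.2 isMulCommutative_centralizer_commutator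

open Subgroup in
theorem ncard_Cent_of_center_eq_bot {Q : Type*} [Group Q] [Finite Q] {p q r : ℕ}
    (hp : p.Prime) (hq : q.Prime) (hr : r.Prime) (hpq : p < q) (hqr : q < r)
    (hcard : Nat.card Q = p * q * r) (hcenter : center Q = ⊥) (hZ : IsZGroup Q) :
    (Cent Q).ncard = r + 2 ∨ (Cent Q).ncard = q * r + 2 := by
  let K : Subgroup Q := centralizer (commutator Q : Set Q)
  have hself : centralizer (K : Set Q) = K := centralizer_centralizer_commutator
  have hcomm : IsMulCommutative K := isMulCommutative_centralizer_commutator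
  have hnontriv : Nontrivial Q := by
    rw [← Finite.one_lt_card_iff_nontrivial, hcard]
    exact Nat.one_lt_mul_iff.2 ⟨Nat.mul_pos hp.pos hq.pos, hr.pos, .inr hr.one_lt⟩
  have hbot : K ≠ ⊥ := by
    intro h
    rw [h, coe_bot, centralizer_eq_top_iff_subset.2 (by simp)] at hself
    exact bot_ne_top hself.symm
  have htop : K ≠ ⊤ := by
    intro h
    rw [h, coe_top, centralizer_univ, hcenter] at hself
    exact bot_ne_top hself
  have hKcyc : IsCyclic K := by
    let _ : CommGroup K := { (inferInstance : Group K) with mul_comm := hcomm.is_comm.comm }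
    have : IsCyclic K := inferInstance
    exact this
  have hQcyc : IsCyclic (Q ⧸ K) := by
    have hle : commutator Q ≤ K := by
      have : IsCyclic (commutator Q) := IsZGroup.isCyclic_commutator Q
      exact le_centralizer (commutator Q)
    have : IsCyclic (Q ⧸ commutator Q) := IsZGroup.isCyclic_abelianization
    refine isCyclic_of_surjective (QuotientGroup.map (commutator Q) K (MonoidHom.id Q) hle) ?_
    intro x
    obtain ⟨y, rfl⟩ := QuotientGroup.mk_surjective x
    exact ⟨y, rfl⟩
  have hmn : Nat.card K * K.index = p * q * r := by rw [card_mul_index, hcard]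
  have hm : Nat.card K ≠ 1 := fun h => hbot (card_eq_one.1 h)
  have hn : K.index ≠ 1 := fun h => htop (index_eq_one.1 h)
  have hprime : (Nat.card K).Prime ∨ K.index.Prime := by
    have hm0 : Nat.card K ≠ 0 := Nat.card_pos.ne'
    have hn0 : K.index ≠ 0 := index_ne_zero_of_finite
    have h1 := congrArg ArithmeticFunction.cardFactors hmn
    rw [ArithmeticFunction.cardFactors_mul hm0 hn0,
      ArithmeticFunction.cardFactors_mul (mul_ne_zero hp.ne_zero hq.ne_zero) hr.ne_zero,
      ArithmeticFunction.cardFactors_mul hp.ne_zero hq.ne_zero,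
      ArithmeticFunction.cardFactors_apply_prime hp, ArithmeticFunction.cardFactors_apply_prime hq,
      ArithmeticFunction.cardFactors_apply_prime hr] at h1
    rw [← ArithmeticFunction.cardFactors_eq_one_iff_prime,
      ← ArithmeticFunction.cardFactors_eq_one_iff_prime]
    have h2 := mt ArithmeticFunction.cardFactors_eq_zero_iff_eq_zero_or_one.1 (not_or.2 ⟨hm0, hm⟩)
    have h3 := mt ArithmeticFunction.cardFactors_eq_zero_iff_eq_zero_or_one.1 (not_or.2 ⟨hn0, hn⟩)
    omega
  have hK (k : Q) (hk : k ∈ K) (hne : k ≠ 1) : centralizer {k} = K :=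
    centralizer_singleton_eq_of_prime K hself hcenter hprime hk hne
  rw [ncard_Cent_of_centralizer_eq K hbot htop hK]
  rcases eq_or_eq_mul_of_mul_eq_of_lt_prime hp hq hr hpq hqr hmn hm hn
    fun t ht htK => index_lt_of_centralizer_eq K hK ht htK with h | h
  · exact .inl (by rw [h])
  · exact .inr (by rw [h])

theorem card_cent_of_central_quotient_pqr
    (G : Type*) [Group G] [Finite G] (p q r : ℕ)
    (hp : p.Prime) (hq : q.Prime) (hr : r.Prime)
    (hpq : p < q) (hqr : q < r)
    (h : Nat.card (G ⧸ Subgroup.center G) = p * q * r) :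
    (Cent G).ncard = r + 2 ∨ (Cent G).ncard = q * r + 2 := by
  have hsq : Squarefree (Nat.card (G ⧸ Subgroup.center G)) := by
    have hpq' : p.Coprime q := (Nat.coprime_primes hp hq).2 hpq.ne
    have hpr : p.Coprime r := (Nat.coprime_primes hp hr).2 (hpq.trans hqr).ne
    have hqr' : q.Coprime r := (Nat.coprime_primes hq hr).2 hqr.ne
    rw [h, Nat.squarefree_mul (hpr.mul_left hqr'), Nat.squarefree_mul hpq']
    exact ⟨⟨hp.prime.squarefree, hq.prime.squarefree⟩, hr.prime.squarefree⟩
  rw [ncard_Cent_quotient_center hsq]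
  exact ncard_Cent_of_center_eq_bot hp hq hr hpq hqr h (center_quotient_center_eq_bot hsq)
    (.of_squarefree hsq)
end

section
/- Let G be a group of order p²q with p < q primes. Then G is capable if and only if Z(G) is trivial or G is isomorphic to C_p × (C_q ⋊ C_p), the direct product of a cyclic group of order p with a nonabelian semidirect product of C_q by C_p. -/
def Capable (G : Type*) [Group G] : Prop :=
  ∃ (H : Type) (_ : Group H), Nonempty (G ≃* H ⧸ Subgroup.center H)

theorem capable_of_surjective {G : Type*} [Group G] {H : Type} [Group H] (f : H →* G)
    (hf : Function.Surjective f) (hker : f.ker = Subgroup.center H) : Capable G :=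
  ⟨H, inferInstance, ⟨((QuotientGroup.quotientMulEquivOfEq hker.symm).trans
    (QuotientGroup.quotientKerEquivOfSurjective f hf)).symm⟩⟩

theorem Capable.of_mulEquiv {G G' : Type*} [Group G] [Group G'] (e : G ≃* G')
    (h : Capable G') : Capable G := by
  obtain ⟨H, hH, ⟨e'⟩⟩ := h
  exact ⟨H, hH, ⟨e.trans e'⟩⟩

theorem capable_of_center_eq_bot {G : Type*} [Group G] [Finite G]
    (h : Subgroup.center G = ⊥) : Capable G := by
  let e : Shrink.{0} G ≃* G := Shrink.mulEquiv
  refine capable_of_surjective e.toMonoidHom e.surjective ?_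
  have hker : e.toMonoidHom.ker = ⊥ := (MonoidHom.ker_eq_bot_iff _).2 e.injective
  rw [hker, eq_comm, Subgroup.eq_bot_iff_forall]
  intro x hx
  have hx' : e x ∈ Subgroup.center G := by
    rw [Subgroup.mem_center_iff] at hx ⊢
    intro g
    rw [← e.apply_symm_apply g, ← map_mul, ← map_mul, hx]
  rw [h, Subgroup.mem_bot] at hx'
  exact e.injective (hx'.trans (map_one e).symm)

/-- The central extension of `G` by the additive group of a commutative ring `R` attached to the
bilinear cocycle `(g, h) ↦ α g * β h`. -/
structure BilinearExtension {G R : Type} [Group G] [CommRing R]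
    (α β : G →* Multiplicative R) where
  base : G
  fiber : R

namespace BilinearExtension

variable {G R : Type} [Group G] [CommRing R] (α β : G →* Multiplicative R)

instance : Group (BilinearExtension α β) where
  mul x y := ⟨x.base * y.base,
    x.fiber + y.fiber + (α x.base).toAdd * (β y.base).toAdd⟩
  one := ⟨1, 0⟩
  inv x := ⟨x.base⁻¹, -x.fiber + (α x.base).toAdd * (β x.base).toAdd⟩
  mul_assoc x y z := by
    refine congrArg₂ mk (mul_assoc _ _ _) ?_
    change x.fiber + y.fiber + _ + z.fiber + (α (x.base * y.base)).toAdd * _ =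
      x.fiber + (y.fiber + z.fiber + _) + _ * (β (y.base * z.base)).toAdd
    rw [map_mul α, map_mul β, toAdd_mul, toAdd_mul]
    ring
  one_mul x := by
    refine congrArg₂ mk (one_mul _) ?_
    change 0 + x.fiber + (α 1).toAdd * _ = _
    simp
  mul_one x := by
    refine congrArg₂ mk (mul_one _) ?_
    change x.fiber + 0 + _ * (β 1).toAdd = _
    simp
  inv_mul_cancel x := by
    refine congrArg₂ mk (inv_mul_cancel _) ?_
    change -x.fiber + _ + x.fiber + (α x.base⁻¹).toAdd * _ = 0
    simp

theorem mul_def (x y : BilinearExtension α β) :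
    x * y = ⟨x.base * y.base, x.fiber + y.fiber + (α x.base).toAdd * (β y.base).toAdd⟩ := rfl

/-- The projection of a bilinear extension onto its base. -/
def proj : BilinearExtension α β →* G where
  toFun := base
  map_one' := rfl
  map_mul' _ _ := rfl

theorem capable
    (h : ∀ g ∈ Subgroup.center G,
      (∀ k, (α g).toAdd * (β k).toAdd = (α k).toAdd * (β g).toAdd) → g = 1) :
    Capable G := by
  refine capable_of_surjective (proj α β) (fun g => ⟨⟨g, 0⟩, rfl⟩) ?_
  ext x
  rw [MonoidHom.mem_ker, Subgroup.mem_center_iff]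
  constructor
  · intro hx y
    have hx' : x.base = 1 := hx
    simp [mul_def, hx', add_comm]
  · intro hx
    refine h x.base (Subgroup.mem_center_iff.2 fun g => ?_) fun k => ?_
    · exact congrArg base (hx ⟨g, 0⟩)
    · have := congrArg fiber (hx ⟨k, 0⟩)
      simp only [mul_def] at this
      linear_combination -this

end BilinearExtension

theorem capable_prod_semidirectProduct {p q : ℕ} (hp : p.Prime) (hq : q.Prime)
    {φ : Multiplicative (ZMod p) →* MulAut (Multiplicative (ZMod q))} (hφ : φ ≠ 1) :
    Capable (Multiplicative (ZMod p) ×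
      (Multiplicative (ZMod q) ⋊[φ] Multiplicative (ZMod p))) := by
  have : Fact p.Prime := ⟨hp⟩
  have : Fact q.Prime := ⟨hq⟩
  refine BilinearExtension.capable (R := ZMod p) (MonoidHom.fst _ _)
    ((SemidirectProduct.rightHom (φ := φ)).comp (MonoidHom.snd _ _)) ?_
  rintro ⟨a, ⟨x, b⟩⟩ hc hk
  have ha : a = 1 := by
    have h1 := hk (1, SemidirectProduct.inr (Multiplicative.ofAdd 1))
    simpa using h1
  rw [Subgroup.mem_center_iff] at hc
  have hinl (u : Multiplicative (ZMod q)) : φ b u = u := by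
    have h1 := congrArg (fun t => t.snd.left) (hc (1, SemidirectProduct.inl u))
    simp only [Prod.mk_mul_mk, SemidirectProduct.mul_left, SemidirectProduct.left_inl,
      SemidirectProduct.right_inl, map_one, MulAut.one_apply] at h1
    exact (mul_left_cancel ((mul_comm x u).trans h1)).symm
  have hinr (c : Multiplicative (ZMod p)) : φ c x = x := by
    have h1 := congrArg (fun t => t.snd.left) (hc (1, SemidirectProduct.inr c))
    simpa using h1
  have hb : b = 1 := by
    by_contra hb
    refine hφ (MonoidHom.ext fun c => ?_)
    have hcard : Nat.card (Multiplicative (ZMod p)) = p := by simp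
    obtain ⟨n, rfl⟩ := Subgroup.mem_zpowers_iff.1 (mem_zpowers_of_prime_card hcard hb (g' := c))
    have : φ b = 1 := MulEquiv.ext hinl
    simp [this]
  have hx : x = 1 := by
    by_contra hx
    refine hφ (MonoidHom.ext fun c => MulEquiv.ext fun u => ?_)
    have hcard : Nat.card (Multiplicative (ZMod q)) = q := by simp
    obtain ⟨n, rfl⟩ := Subgroup.mem_zpowers_iff.1 (mem_zpowers_of_prime_card hcard hx (g' := u))
    simp [hinr]
  subst ha hb hx
  rfl

open scoped commutatorElement in
/-- If `G` is the central quotient of `H` and `z` is central in `G`, then taking commutators with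
a lift of `z` is a homomorphism on `G`. -/
theorem Capable.exists_monoidHom {G : Type*} [Group G] (h : Capable G) {z : G}
    (hz : z ∈ Subgroup.center G) (hz1 : z ≠ 1) :
    ∃ (A : Type) (_ : Group A) (f : G →* A), f ≠ 1 ∧
      (∀ g, z ∈ Subgroup.zpowers g → f g = 1) ∧ ∀ n : ℕ, z ^ n = 1 → ∀ g, f g ^ n = 1 := by
  obtain ⟨H, hH, ⟨e⟩⟩ := h
  obtain ⟨w, hw⟩ := QuotientGroup.mk_surjective (e z)
  have hcomm (k : H) : ⁅w, k⁆ ∈ Subgroup.center H := by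
    rw [← QuotientGroup.eq_one_iff, ← QuotientGroup.mk'_apply, map_commutatorElement,
      commutatorElement_eq_one_iff_mul_comm, QuotientGroup.mk'_apply, QuotientGroup.mk'_apply, hw,
      ← e.apply_symm_apply (k : H ⧸ Subgroup.center H), ← map_mul, ← map_mul,
      Subgroup.mem_center_iff.1 hz]
  have hconj (k : H) : w * k * w⁻¹ = ⁅w, k⁆ * k := by simp [commutatorElement_def]
  let F : H →* H :=
    { toFun := fun k => ⁅w, k⁆
      map_one' := by simp
      map_mul' := fun a b => by
        apply mul_right_cancel (b := a * b)
        rw [← hconj, ← conj_mul, hconj a, hconj b, mul_assoc, mul_assoc,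
          ← mul_assoc a, Subgroup.mem_center_iff.1 (hcomm b) a, mul_assoc] }
  have hF (k : H) : F k = ⁅w, k⁆ := rfl
  have hFker : ∀ k ∈ Subgroup.center H, F k = 1 := fun k hk => by
    rw [hF, commutatorElement_eq_one_iff_mul_comm, Subgroup.mem_center_iff.1 hk]
  let L := QuotientGroup.lift (Subgroup.center H) F hFker
  have hL (g : G) (k : H) (hk : (k : H ⧸ Subgroup.center H) = e g) :
      L.comp e.toMonoidHom g = ⁅w, k⁆ := by
    change L (e g) = _
    rw [← hk]
    rfl
  refine ⟨H, hH, L.comp e.toMonoidHom, fun hf => ?_, fun g hg => ?_, fun n hn g => ?_⟩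
  · apply hz1
    apply e.injective
    rw [← hw, map_one, QuotientGroup.eq_one_iff, Subgroup.mem_center_iff]
    intro k
    have h1 := hL (e.symm k) k (by simp)
    rw [hf, MonoidHom.one_apply, eq_comm, commutatorElement_eq_one_iff_mul_comm] at h1
    exact h1.symm
  · obtain ⟨k, hk⟩ := QuotientGroup.mk_surjective (e g)
    obtain ⟨n, hn⟩ := Subgroup.mem_zpowers_iff.1 hg
    rw [hL g k hk, commutatorElement_eq_one_iff_commute]
    have hc : (k ^ n)⁻¹ * w ∈ Subgroup.center H := by
      rw [← QuotientGroup.eq, hw, ← hn, QuotientGroup.mk_zpow, hk, map_zpow]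
    have hc' : Commute ((k ^ n)⁻¹ * w) k := (Subgroup.mem_center_iff.1 hc k).symm
    have := ((Commute.refl k).zpow_left n).mul_left hc'
    rwa [mul_inv_cancel_left] at this
  · obtain ⟨k, hk⟩ := QuotientGroup.mk_surjective (e g)
    rw [hL g k hk]
    have hpow (m : ℕ) : w ^ m * k * (w ^ m)⁻¹ = ⁅w, k⁆ ^ m * k := by
      induction m with
      | zero => simp
      | succ m ih =>
        have h1 : w ^ (m + 1) * k * (w ^ (m + 1))⁻¹ = w * (w ^ m * k * (w ^ m)⁻¹) * w⁻¹ := by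
          group
        have h2 : Commute w (⁅w, k⁆ ^ m) :=
          Commute.pow_right (Subgroup.mem_center_iff.1 (hcomm k) w) m
        rw [h1, ih, ← mul_assoc, h2.eq, mul_assoc, mul_assoc, ← mul_assoc w, hconj, pow_succ,
          mul_assoc]
    have hc : w ^ n ∈ Subgroup.center H := by
      rw [← QuotientGroup.eq_one_iff, QuotientGroup.mk_pow, hw, ← map_pow, hn, map_one]
    have h3 := hpow n
    rw [← Subgroup.mem_center_iff.1 hc k, mul_inv_cancel_right] at h3
    exact (mul_eq_right.1 h3.symm)

theorem eq_one_of_pow_eq_one_of_coprime {A : Type*} [Group A] {a : A} {m n : ℕ}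
    (h : m.Coprime n) (hm : a ^ m = 1) (hn : a ^ n = 1) : a = 1 := by
  have := Nat.dvd_gcd (orderOf_dvd_of_pow_eq_one hm) (orderOf_dvd_of_pow_eq_one hn)
  rw [h.gcd_eq_one, Nat.dvd_one] at this
  exact orderOf_eq_one_iff.1 this

/-- In a capable group, a central cyclic subgroup whose order is coprime to its index is trivial. -/
theorem Capable.eq_one_of_coprime_index {G : Type*} [Group G] (h : Capable G) {z : G}
    (hz : z ∈ Subgroup.center G)
    (hco : (orderOf z).Coprime (Subgroup.zpowers z).index) : z = 1 := by
  by_contra hz1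
  obtain ⟨A, _, f, hf1, hf2, hf3⟩ := h.exists_monoidHom hz hz1
  refine hf1 (MonoidHom.ext fun g => ?_)
  have hn : (Subgroup.zpowers z).Normal := ⟨fun a ha g => by
    have hle : Subgroup.zpowers z ≤ Subgroup.center G := by simpa using hz
    rwa [Subgroup.mem_center_iff.1 (hle ha) g, mul_inv_cancel_right]⟩
  refine eq_one_of_pow_eq_one_of_coprime hco (hf3 _ (pow_orderOf_eq_one z) g) ?_
  rw [← map_pow]
  obtain ⟨k, hk⟩ := Subgroup.mem_zpowers_iff.1 ((Subgroup.zpowers z).pow_index_mem g)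
  rw [← hk, map_zpow, hf2 z (Subgroup.mem_zpowers z), one_zpow]

theorem exists_mulEquiv_prod_semidirectProduct {G : Type*} [Group G] {p q : ℕ}
    (hcard : Nat.card G = p ^ 2 * q) [Fact p.Prime] [Fact q.Prime] (Q : Subgroup G) [Q.Normal]
    (hQ : Nat.card Q = q) {y z : G} (hy : orderOf y = p) (hz : orderOf z = p)
    (hzc : z ∈ Subgroup.center G) (hQc : ¬ Q ≤ Subgroup.center G)
    (hind : ∀ a ∈ Subgroup.zpowers z, ∀ x ∈ Q, ∀ b ∈ Subgroup.zpowers y,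
      a * (x * b) = 1 → a = 1 ∧ x = 1 ∧ b = 1) :
    ∃ φ : Multiplicative (ZMod p) →* MulAut (Multiplicative (ZMod q)), φ ≠ 1 ∧
      Nonempty (G ≃* Multiplicative (ZMod p) ×
        (Multiplicative (ZMod q) ⋊[φ] Multiplicative (ZMod p))) := by
  let eQ : Multiplicative (ZMod q) ≃* Q := mulEquivOfPrimeCardEq (p := q) (by simp) hQ
  let eY : Multiplicative (ZMod p) ≃* Subgroup.zpowers y :=
    mulEquivOfPrimeCardEq (p := p) (by simp) (by rw [Nat.card_zpowers, hy])
  let eZ : Multiplicative (ZMod p) ≃* Subgroup.zpowers z :=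
    mulEquivOfPrimeCardEq (p := p) (by simp) (by rw [Nat.card_zpowers, hz])
  let iY : Multiplicative (ZMod p) →* G := (Subgroup.zpowers y).subtype.comp eY.toMonoidHom
  let iZ : Multiplicative (ZMod p) →* G := (Subgroup.zpowers z).subtype.comp eZ.toMonoidHom
  let iQ : Multiplicative (ZMod q) →* G := Q.subtype.comp eQ.toMonoidHom
  let φ : Multiplicative (ZMod p) →* MulAut (Multiplicative (ZMod q)) :=
    (MulAut.congr eQ.symm).toMonoidHom.comp ((MulAut.conjNormal (H := Q)).comp iY)
  have hφ (b : Multiplicative (ZMod p)) (x : Multiplicative (ZMod q)) :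
      iQ (φ b x) = iY b * iQ x * (iY b)⁻¹ := by
    change ((eQ (eQ.symm (MulAut.conjNormal (iY b) (eQ x))) : Q) : G) = _
    rw [MulEquiv.apply_symm_apply, MulAut.conjNormal_apply]
    rfl
  let S : Multiplicative (ZMod q) ⋊[φ] Multiplicative (ZMod p) →* G :=
    SemidirectProduct.lift iQ iY fun b => MonoidHom.ext fun x => hφ b x
  have hcen : ∀ a g, Commute (iZ a) g := fun a g => by
    have h1 : Subgroup.zpowers z ≤ Subgroup.center G := by simpa using hzc
    exact (Subgroup.mem_center_iff.1 (h1 (eZ a).2) g).symm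
  let T := MonoidHom.noncommCoprod iZ S fun a s => hcen a (S s)
  have hT (a : Multiplicative (ZMod p)) (s) : T (a, s) = iZ a * (iQ s.left * iY s.right) := rfl
  have hinj : Function.Injective T := by
    rw [injective_iff_map_eq_one]
    rintro ⟨a, s⟩ h
    rw [hT] at h
    obtain ⟨h1, h2, h3⟩ := hind _ (eZ a).2 _ (eQ s.left).2 _ (eY s.right).2 h
    have h1' : a = 1 := by simpa using h1
    have h2' : s.left = 1 := by simpa using h2
    have h3' : s.right = 1 := by simpa using h3
    exact Prod.ext h1' (SemidirectProduct.ext h2' h3')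
  have hfin : Finite G := Nat.finite_of_card_ne_zero (by
    rw [hcard]
    exact mul_ne_zero (pow_ne_zero _ (NeZero.ne p)) (NeZero.ne q))
  have hbij : Function.Bijective T := by
    refine (Nat.bijective_iff_injective_and_card T).2 ⟨hinj, ?_⟩
    rw [hcard, Nat.card_prod, SemidirectProduct.card]
    have hm (n : ℕ) : Nat.card (Multiplicative (ZMod n)) = n := Nat.card_zmod n
    rw [hm, hm]
    ring
  refine ⟨φ, fun h1 => hQc fun x hx => ?_, ⟨(MulEquiv.ofBijective T hbij).symm⟩⟩
  obtain ⟨x, rfl⟩ : ∃ u, iQ u = x := ⟨eQ.symm ⟨x, hx⟩, by simp [iQ]⟩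
  rw [Subgroup.mem_center_iff]
  intro g
  obtain ⟨⟨a, s⟩, rfl⟩ := hbij.surjective g
  rw [hT]
  have h2 : Commute (iY s.right) (iQ x) := by
    have h3 : φ s.right x = x := by
      rw [DFunLike.congr_fun h1 s.right, MonoidHom.one_apply, MulAut.one_apply]
    have h4 := hφ s.right x
    rw [h3, eq_mul_inv_iff_mul_eq] at h4
    exact h4.symm
  have h3 : Commute (iQ s.left) (iQ x) := (Commute.all s.left x).map iQ
  exact ((hcen a _).mul_left (h3.mul_left h2)).eq

theorem Sylow.normal_of_lt_of_orderOf_eq {G : Type*} [Group G] [Finite G] {p q : ℕ}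
    [Fact p.Prime] [Fact q.Prime] (hpq : p < q) (hcard : Nat.card G = p ^ 2 * q) (Q : Sylow q G)
    (hQ : Nat.card Q = q) {z : G} (hz : z ∈ Subgroup.center G) (hzp : orderOf z = p) :
    (Q : Subgroup G).Normal := by
  have hp : p.Prime := Fact.out
  have hq : q.Prime := Fact.out
  have h1 : p ∣ Nat.card (Subgroup.normalizer (Q : Set G)) := by
    have : z ∈ Subgroup.normalizer (Q : Set G) := Subgroup.center_le_normalizer _ hz
    rw [← hzp]
    exact Subgroup.orderOf_dvd_natCard _ this
  have h2 : q ∣ Nat.card (Subgroup.normalizer (Q : Set G)) := by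
    exact hQ.symm.dvd.trans (Subgroup.card_dvd_of_le Subgroup.le_normalizer)
  obtain ⟨c, hc⟩ := Nat.Coprime.mul_dvd_of_dvd_of_dvd
    ((Nat.coprime_primes hp hq).2 hpq.ne) h1 h2
  have h3 := Sylow.card_eq_index_normalizer Q
  have h4 : Nat.card (Sylow q G) ∣ p := by
    refine ⟨c, ?_⟩
    have h5 := (Subgroup.normalizer (Q : Set G)).card_mul_index
    rw [← h3, hc, hcard] at h5
    apply Nat.eq_of_mul_eq_mul_left (mul_pos hp.pos hq.pos)
    linarith
  have h6 := card_sylow_modEq_one q G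
  have h7 : Nat.card (Sylow q G) = 1 := by
    refine Nat.ModEq.eq_of_lt_of_lt h6 ?_ hq.one_lt
    exact (Nat.le_of_dvd hp.pos h4).trans_lt hpq
  rw [h7, eq_comm, Subgroup.index_eq_one] at h3
  exact Subgroup.normalizer_eq_top_iff.1 h3

theorem Capable.exists_mulEquiv_of_center_ne_bot {G : Type*} [Group G] {p q : ℕ}
    (hp : p.Prime) (hq : q.Prime) (hpq : p < q) (hcard : Nat.card G = p ^ 2 * q)
    (h : Capable G) (hcen : Subgroup.center G ≠ ⊥) :
    ∃ φ : Multiplicative (ZMod p) →* MulAut (Multiplicative (ZMod q)), φ ≠ 1 ∧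
      Nonempty (G ≃* Multiplicative (ZMod p) ×
        (Multiplicative (ZMod q) ⋊[φ] Multiplicative (ZMod p))) := by
  have : Fact p.Prime := ⟨hp⟩
  have : Fact q.Prime := ⟨hq⟩
  have hco : p.Coprime q := (Nat.coprime_primes hp hq).2 hpq.ne
  have hfin : Finite G := Nat.finite_of_card_ne_zero (by
    rw [hcard]
    exact mul_ne_zero (pow_ne_zero _ hp.ne_zero) hq.ne_zero)
  have hnoq : ∀ z ∈ Subgroup.center G, orderOf z ≠ q := fun z hz hzq => by
    have h1 := (Subgroup.zpowers z).card_mul_index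
    rw [Nat.card_zpowers, hzq, hcard, mul_comm (p ^ 2)] at h1
    have h2 := Nat.eq_of_mul_eq_mul_left hq.pos h1
    have h3 := h.eq_one_of_coprime_index hz (by rw [hzq, h2]; exact hco.symm.pow_right 2)
    rw [h3, orderOf_one] at hzq
    exact hq.one_lt.ne hzq
  obtain ⟨z, hz, hzp⟩ : ∃ z ∈ Subgroup.center G, orderOf z = p := by
    have h1 : Nat.card (Subgroup.center G) ≠ 1 := by rwa [Ne, Subgroup.card_eq_one]
    obtain ⟨r, hr, hrd⟩ := Nat.exists_prime_and_dvd h1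
    have : Fact r.Prime := ⟨hr⟩
    obtain ⟨⟨z, hz⟩, hzr⟩ := exists_prime_orderOf_dvd_card' r hrd
    rw [Subgroup.orderOf_mk] at hzr
    refine ⟨z, hz, ?_⟩
    have h2 := hrd.trans (Subgroup.card_subgroup_dvd_card _)
    rw [hcard, hr.dvd_mul] at h2
    rcases h2 with h2 | h2
    · rw [hzr, (Nat.prime_dvd_prime_iff_eq hr hp).1 (hr.dvd_of_dvd_pow h2)]
    · exact absurd (hzr.trans ((Nat.prime_dvd_prime_iff_eq hr hq).1 h2)) (hnoq z hz)
  have hz1 : z ≠ 1 := by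
    rintro rfl
    rw [orderOf_one] at hzp
    exact hp.one_lt.ne hzp
  obtain ⟨A, _, f, hf1, hf2, hf3⟩ := h.exists_monoidHom hz hz1
  replace hf3 := hf3 p (hzp ▸ pow_orderOf_eq_one z)
  obtain ⟨Q⟩ : Nonempty (Sylow q G) := inferInstance
  have hQ : Nat.card Q = q := by
    have hqp : ¬ q ∣ p ^ 2 := fun hd => hpq.ne'
      ((Nat.prime_dvd_prime_iff_eq hq hp).1 (hq.dvd_of_dvd_pow hd))
    rw [Q.card_eq_multiplicity, hcard, Nat.factorization_mul (pow_ne_zero _ hp.ne_zero) hq.ne_zero,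
      Finsupp.add_apply, Nat.factorization_eq_zero_of_not_dvd hqp, hq.factorization_self]
    simp
  have hQn := Q.normal_of_lt_of_orderOf_eq hpq hcard hQ hz hzp
  have hQpow : ∀ x ∈ Q, x ^ q = 1 := fun x hx => by
    have := congrArg Subtype.val (pow_card_eq_one' (x := (⟨x, hx⟩ : (Q : Subgroup G))))
    rwa [hQ] at this
  have hQf : ∀ x ∈ Q, f x = 1 := fun x hx =>
    eq_one_of_pow_eq_one_of_coprime hco (hf3 x) (by rw [← map_pow, hQpow x hx, map_one])
  have hzP : IsPGroup p (Subgroup.zpowers z) :=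
    IsPGroup.of_card (n := 1) (by rw [Nat.card_zpowers, hzp, pow_one])
  obtain ⟨P, hP⟩ := hzP.exists_le_sylow
  have hPc : Nat.card P = p ^ 2 := by
    have hqp : ¬ p ∣ q := fun hd => hpq.ne ((Nat.prime_dvd_prime_iff_eq hp hq).1 hd)
    rw [P.card_eq_multiplicity, hcard, Nat.factorization_mul (pow_ne_zero _ hp.ne_zero) hq.ne_zero,
      Finsupp.add_apply, Nat.factorization_eq_zero_of_not_dvd hqp, hp.factorization_pow]
    simp
  obtain ⟨y, hyP, hfy⟩ : ∃ y ∈ P, f y ≠ 1 := by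
    by_contra! hall
    have h1 : p ^ 2 ∣ Nat.card f.ker := hPc ▸ Subgroup.card_dvd_of_le (H := (P : Subgroup G)) hall
    have h2 : q ∣ Nat.card f.ker := by
      conv_lhs => rw [← hQ]
      exact Subgroup.card_dvd_of_le (H := (Q : Subgroup G)) hQf
    have h3 := Nat.Coprime.mul_dvd_of_dvd_of_dvd (hco.pow_left 2) h1 h2
    rw [← hcard] at h3
    have h4 : f.ker = ⊤ := Subgroup.eq_top_of_card_eq _
      (Nat.dvd_antisymm (Subgroup.card_subgroup_dvd_card _) h3)
    exact hf1 (MonoidHom.ext fun g => by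
      have : g ∈ f.ker := h4 ▸ Subgroup.mem_top g
      exact this)
  have hy : orderOf y = p := by
    have hd : orderOf y ∣ p ^ 2 := hPc ▸ Subgroup.orderOf_dvd_natCard (P : Subgroup G) hyP
    obtain ⟨k, hk, hyk⟩ := (Nat.dvd_prime_pow hp).1 hd
    interval_cases k
    · rw [pow_zero, orderOf_eq_one_iff] at hyk
      exact absurd (hyk ▸ map_one f) hfy
    · rw [hyk, pow_one]
    · refine absurd (hf2 y ?_) hfy
      have h1 : Subgroup.zpowers y = P := Subgroup.eq_of_le_of_card_ge (Subgroup.zpowers_le.2 hyP)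
        (by rw [Nat.card_zpowers, hyk]; exact hPc.le)
      rw [h1]
      exact hP (Subgroup.mem_zpowers z)
  refine exists_mulEquiv_prod_semidirectProduct hcard Q hQ hy hzp hz (fun hle => ?_) ?_
  · obtain ⟨x, hx⟩ := exists_prime_orderOf_dvd_card' (G := Q) q (by rw [hQ])
    exact hnoq x (hle x.2) (by rw [Subgroup.orderOf_coe, hx])
  · intro a ha x hx b hb hab
    have hfa : f a = 1 := by
      obtain ⟨k, rfl⟩ := Subgroup.mem_zpowers_iff.1 ha
      rw [map_zpow, hf2 z (Subgroup.mem_zpowers z), one_zpow]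
    have hfb : f b = 1 := by simpa [hfa, hQf x hx] using congrArg f hab
    have hb1 : b = 1 := by
      by_contra hb1
      obtain ⟨k, hk⟩ := Subgroup.mem_zpowers_iff.1 (mem_zpowers_of_prime_card (p := p)
        (G := Subgroup.zpowers y) (by rw [Nat.card_zpowers, hy]) (g := ⟨b, hb⟩)
        (g' := ⟨y, Subgroup.mem_zpowers y⟩) (by simpa using hb1))
      have hk' : b ^ k = y := congrArg Subtype.val hk
      exact hfy (by rw [← hk', map_zpow, hfb, one_zpow])
    subst hb1
    rw [mul_one] at hab
    have hap : a ^ p = 1 := by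
      have := congrArg Subtype.val (pow_card_eq_one' (x := (⟨a, ha⟩ : Subgroup.zpowers z)))
      rwa [Nat.card_zpowers, hzp] at this
    have hax : a = x⁻¹ := eq_inv_of_mul_eq_one_left hab
    have ha1 : a = 1 := eq_one_of_pow_eq_one_of_coprime hco hap
      (by rw [hax, inv_pow, hQpow x hx, inv_one])
    exact ⟨ha1, by simpa [ha1] using hab, rfl⟩

theorem capable_of_order_p_sq_q_iff
    (G : Type*) [Group G] (p q : ℕ)
    (hp : p.Prime) (hq : q.Prime) (hpq : p < q)
    (hcard : Nat.card G = p ^ 2 * q) :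
    Capable G ↔
      (Subgroup.center G = ⊥ ∨
        ∃ φ : Multiplicative (ZMod p) →* MulAut (Multiplicative (ZMod q)),
          φ ≠ 1 ∧
          Nonempty (G ≃*
            Multiplicative (ZMod p) ×
              (Multiplicative (ZMod q) ⋊[φ] Multiplicative (ZMod p)))) := by
  constructor
  · intro h
    exact or_iff_not_imp_left.2 (h.exists_mulEquiv_of_center_ne_bot hp hq hpq hcard)
  · rintro (h | ⟨φ, hφ, ⟨e⟩⟩)
    · have : Finite G := Nat.finite_of_card_ne_zero (by
        rw [hcard]
        exact mul_ne_zero (pow_ne_zero _ hp.ne_zero) hq.ne_zero)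
      exact capable_of_center_eq_bot h
    · exact (capable_prod_semidirectProduct hp hq hφ).of_mulEquiv e
end

section
/- If G is a finite group with G/Z(G) isomorphic to a group of order 12, then |Cent(G)| = 6 or 8. -/
open Subgroup

/-- The image in `G ⧸ center G` of the centralizer of any lift of `q`. -/
noncomputable def centralizerImage {G : Type*} [Group G] (q : G ⧸ center G) :
    Subgroup (G ⧸ center G) :=
  (centralizer {q.out}).map (QuotientGroup.mk' (center G))

section CentralizerImage

variable {G : Type*} [Group G]

theorem commute_mul_center_iff {x y z : G} (hz : z ∈ center G) :
    Commute x (y * z) ↔ Commute x y := by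
  have hxz : Commute x z := mem_center_iff.1 hz x
  refine ⟨fun h => ?_, fun h => h.mul_right hxz⟩
  simpa using h.mul_right hxz.inv_right

theorem mk_mem_centralizerImage {x y : G} :
    (y : G ⧸ center G) ∈ centralizerImage (x : G ⧸ center G) ↔ Commute x y := by
  obtain ⟨z, hz⟩ := QuotientGroup.mk_out_eq_mul (center G) x
  have key (w : G) : w ∈ centralizer {(x : G ⧸ center G).out} ↔ Commute x w := by
    rw [mem_centralizer_singleton_iff, hz, Commute.symm_iff (a := x),
      ← commute_mul_center_iff z.2]
    rfl
  constructor
  · rintro ⟨w, hw, hwy⟩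
    obtain ⟨c, hc⟩ : ∃ c ∈ center G, w * c = y := by
      simpa using (QuotientGroup.mk'_eq_mk' _).1 hwy
    rw [← hc.2, commute_mul_center_iff hc.1]
    exact (key w).1 hw
  · exact fun h => ⟨y, (key y).2 h, rfl⟩

theorem comap_centralizerImage (x : G) :
    (centralizerImage (x : G ⧸ center G)).comap (QuotientGroup.mk' (center G)) =
      centralizer {x} := by
  ext y
  rw [mem_comap, QuotientGroup.mk'_apply, mk_mem_centralizerImage,
    mem_centralizer_singleton_iff, Commute.symm_iff]
  rfl

theorem ncard_cent_eq :
    (Cent G).ncard = (Set.range (centralizerImage (G := G))).ncard := by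
  have h : Cent G = comap (QuotientGroup.mk' (center G)) ''
      Set.range (centralizerImage (G := G)) := by
    ext H
    constructor
    · rintro ⟨x, rfl⟩
      exact ⟨_, ⟨x, rfl⟩, comap_centralizerImage x⟩
    · rintro ⟨_, ⟨q, rfl⟩, rfl⟩
      induction q using QuotientGroup.induction_on with
      | H x => exact ⟨x, comap_centralizerImage x⟩
  rw [h, Set.ncard_image_of_injective]
  exact comap_injective (QuotientGroup.mk'_surjective _)

theorem self_mem_centralizerImage (q : G ⧸ center G) : q ∈ centralizerImage q := by
  induction q using QuotientGroup.induction_on with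
  | H x => exact mk_mem_centralizerImage.2 (Commute.refl x)

theorem mem_centralizerImage_comm {p q : G ⧸ center G} :
    p ∈ centralizerImage q ↔ q ∈ centralizerImage p := by
  induction q using QuotientGroup.induction_on with
  | H x =>
    induction p using QuotientGroup.induction_on with
    | H y => rw [mk_mem_centralizerImage, mk_mem_centralizerImage, Commute.symm_iff]

theorem centralizerImage_eq_top {q : G ⧸ center G} : centralizerImage q = ⊤ ↔ q = 1 := by
  induction q using QuotientGroup.induction_on with
  | H x =>
    rw [QuotientGroup.eq_one_iff, mem_center_iff, eq_top_iff']
    constructor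
    · exact fun h y => (mk_mem_centralizerImage.1 (h y)).symm
    · intro h p
      induction p using QuotientGroup.induction_on with
      | H y => exact mk_mem_centralizerImage.2 (h y).symm

theorem mem_centralizerImage_of_sq_of_cube {p q : G ⧸ center G} (hpq : Commute p q)
    (hp : p ^ 2 = 1) (hq : q ^ 3 = 1) : p ∈ centralizerImage q := by
  induction q using QuotientGroup.induction_on with
  | H x =>
    induction p using QuotientGroup.induction_on with
    | H y =>
      rw [mk_mem_centralizerImage]
      obtain ⟨z, hz, hzxy⟩ : ∃ z ∈ center G, x * y * z = y * x :=
        (QuotientGroup.mk'_eq_mk' (center G)).1 hpq.eq.symm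
      have hcz (g : G) : Commute g z := mem_center_iff.1 hz g
      have hx : x ^ 3 ∈ center G := (QuotientGroup.eq_one_iff _).1 hq
      have hy : y ^ 2 ∈ center G := (QuotientGroup.eq_one_iff _).1 hp
      have hconj : y * x * y⁻¹ = x * z := by
        rw [← hzxy, mul_assoc x, (hcz y).eq]; group
      have hz3 : z ^ 3 = 1 := by
        have h : (y * x * y⁻¹) ^ 3 = x ^ 3 := by
          rw [conj_pow, mem_center_iff.1 hx y]; group
        rwa [hconj, (hcz x).mul_pow, mul_eq_left] at h
      have hconj' : y⁻¹ * x * y = x * z⁻¹ := by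
        rw [eq_mul_inv_iff_mul_eq, mul_assoc, mul_assoc, ← mul_assoc x, hzxy]; group
      have hz2 : z ^ 2 = 1 := by
        have h : y * x * y⁻¹ = y⁻¹ * x * y :=
          calc y * x * y⁻¹ = y⁻¹ * (y ^ 2 * x) * y⁻¹ := by group
            _ = y⁻¹ * x * y := by rw [← mem_center_iff.1 hy x]; group
        rw [hconj, hconj', mul_right_inj] at h
        rw [sq]; nth_rw 1 [h]; simp
      have hz1 : z = 1 := by simpa [pow_succ z 2, hz2] using hz3
      rw [hz1, mul_one] at hzxy
      exact hzxy

theorem centralizerImage_ne_bot {q : G ⧸ center G} (hq : q ≠ 1) : centralizerImage q ≠ ⊥ :=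
  fun h => hq (by simpa [h] using self_mem_centralizerImage q)

end CentralizerImage

section CentralQuotientTwelve

variable {G : Type*} [Group G] [Finite G]

theorem card_centralizerImage (h : Nat.card (G ⧸ center G) = 12) {q : G ⧸ center G}
    (hq : q ≠ 1) :
    Nat.card (centralizerImage q) ∈ ({2, 3, 4, 6} : Finset ℕ) := by
  have hd : Nat.card (centralizerImage q) ∣ 12 := h ▸ card_subgroup_dvd_card _
  have h1 : Nat.card (centralizerImage q) ≠ 1 := fun h1 =>
    centralizerImage_ne_bot hq (card_eq_one.1 h1)
  have h12 : Nat.card (centralizerImage q) ≠ 12 := fun h12 =>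
    hq (centralizerImage_eq_top.1 ((card_eq_iff_eq_top _).1 (h12.trans h.symm)))
  have hmem : Nat.card (centralizerImage q) ∈ Nat.divisors 12 := Nat.mem_divisors.2 ⟨hd, by simp⟩
  rw [show Nat.divisors 12 = {1, 2, 3, 4, 6, 12} by decide] at hmem
  simp only [Finset.mem_insert, Finset.mem_singleton] at hmem ⊢
  omega

theorem centralizerImage_le_of_mem (h : Nat.card (G ⧸ center G) = 12) {p q : G ⧸ center G}
    (hq : q ≠ 1) (hp : p ∈ centralizerImage q) :
    centralizerImage q ≤ centralizerImage p := by
  set Z := centralizerImage q ⊓ ⨅ u ∈ centralizerImage q, centralizerImage u with hZ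
  have memZ {v} : v ∈ Z ↔ v ∈ centralizerImage q ∧ centralizerImage q ≤ centralizerImage v := by
    simp only [hZ, mem_inf, mem_iInf, SetLike.le_def]
    exact and_congr_right fun _ => forall₂_congr fun _ _ => mem_centralizerImage_comm
  by_contra hpq
  have hpZ : p ∉ Z := fun hmem => hpq (memZ.1 hmem).2
  have hqZ : q ∈ Z := memZ.2 ⟨self_mem_centralizerImage q, le_rfl⟩
  set E := centralizerImage p ⊓ centralizerImage q with hE
  have hZE : Z ≤ E := fun v hv =>
    ⟨mem_centralizerImage_comm.1 ((memZ.1 hv).2 hp), (memZ.1 hv).1⟩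
  have hZ1 : Nat.card Z ≠ 1 := fun h1 => hq (by simpa [card_eq_one.1 h1] using hqZ)
  have hZE' : Nat.card Z ≠ Nat.card E := fun heq =>
    hpZ ((eq_of_le_of_card_ge hZE heq.ge) ▸ ⟨self_mem_centralizerImage p, hp⟩)
  have hEq' : Nat.card E ≠ Nat.card (centralizerImage q) := fun heq =>
    hpq (inf_eq_right.1 (eq_of_le_of_card_ge inf_le_right heq.ge))
  obtain ⟨a, ha⟩ := card_dvd_of_le hZE
  obtain ⟨b, hb⟩ : Nat.card E ∣ Nat.card (centralizerImage q) := card_dvd_of_le inf_le_right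
  have hcard := card_centralizerImage h hq
  simp only [Finset.mem_insert, Finset.mem_singleton] at hcard
  have hEpos : 0 < Nat.card E := Nat.card_pos
  have hZ2 : 2 ≤ Nat.card Z := by have : 0 < Nat.card Z := Nat.card_pos; omega
  have ha2 : 2 ≤ a := by
    by_contra! hlt
    interval_cases a <;> omega
  have hb2 : 2 ≤ b := by
    by_contra! hlt
    interval_cases b <;> omega
  have : 2 * 2 * 2 ≤ Nat.card (centralizerImage q) := by
    rw [hb, ha]; gcongr
  omega

theorem centralizerImage_eq_iff (h : Nat.card (G ⧸ center G) = 12) {p q : G ⧸ center G}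
    (hp : p ≠ 1) (hq : q ≠ 1) :
    centralizerImage p = centralizerImage q ↔ p ∈ centralizerImage q := by
  refine ⟨fun hpq => hpq ▸ self_mem_centralizerImage p, fun hpq => le_antisymm ?_ ?_⟩
  · exact centralizerImage_le_of_mem h hp (mem_centralizerImage_comm.1 hpq)
  · exact centralizerImage_le_of_mem h hq hpq

open Classical in
/-- The images in `G ⧸ center G` of the centralizers of noncentral elements. -/
noncomputable def properCentralizerImages (G : Type*) [Group G] [Finite G] :
    Finset (Subgroup (G ⧸ center G)) :=
  (Set.toFinite {q : G ⧸ center G | q ≠ 1}).toFinset.image centralizerImage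

theorem mem_properCentralizerImages {H : Subgroup (G ⧸ center G)} :
    H ∈ properCentralizerImages G ↔ ∃ q, q ≠ 1 ∧ centralizerImage q = H := by
  simp [properCentralizerImages]

theorem ncard_cent_eq_card_add_one :
    (Cent G).ncard = (properCentralizerImages G).card + 1 := by
  classical
  have hrange : Set.range (centralizerImage (G := G)) =
      insert ⊤ (properCentralizerImages G : Set (Subgroup (G ⧸ center G))) := by
    ext H
    simp only [Set.mem_range, Set.mem_insert_iff, Finset.mem_coe, mem_properCentralizerImages]
    constructor
    · rintro ⟨q, rfl⟩
      by_cases hq : q = 1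
      · exact .inl (centralizerImage_eq_top.2 hq)
      · exact .inr ⟨q, hq, rfl⟩
    · rintro (rfl | ⟨q, -, rfl⟩)
      · exact ⟨1, centralizerImage_eq_top.2 rfl⟩
      · exact ⟨q, rfl⟩
  rw [ncard_cent_eq, hrange, Set.ncard_insert_of_notMem _ (Finset.finite_toSet _),
    Set.ncard_coe_finset]
  rw [Finset.mem_coe, mem_properCentralizerImages]
  exact fun ⟨q, hq, htop⟩ => hq (centralizerImage_eq_top.1 htop)

theorem sum_card_sub_one_properCentralizerImages (h : Nat.card (G ⧸ center G) = 12) :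
    ∑ H ∈ properCentralizerImages G, (Nat.card H - 1) = 11 := by
  classical
  have hcompl (H : Subgroup (G ⧸ center G)) :
      ((H : Set (G ⧸ center G)) \ {1}).ncard = Nat.card H - 1 :=
    Set.ncard_sdiff_singleton_of_mem H.one_mem
  have htotal : (Set.toFinite {q : G ⧸ center G | q ≠ 1}).toFinset.card = 11 := by
    rw [← Set.ncard_eq_toFinset_card]
    have := hcompl ⊤
    rw [card_top, h] at this
    have hset : {q : G ⧸ center G | q ≠ 1} =
        ((⊤ : Subgroup (G ⧸ center G)) : Set (G ⧸ center G)) \ {1} := by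
      ext; simp
    rw [hset, this]
  rw [← htotal, Finset.card_eq_sum_card_image centralizerImage]
  refine Finset.sum_congr rfl fun H hH => ?_
  obtain ⟨q, hq, rfl⟩ := mem_properCentralizerImages.1 hH
  rw [← hcompl, ← Set.ncard_coe_finset]
  congr 1
  ext p
  simp only [Set.mem_sdiff, SetLike.mem_coe, Set.mem_singleton_iff, Finset.coe_filter,
    Set.Finite.mem_toFinset, Set.mem_ofPred_eq]
  rw [and_comm]
  exact and_congr_right fun hp => (centralizerImage_eq_iff h hp hq).symm

theorem card_mul_card_le_of_mem_properCentralizerImages (h : Nat.card (G ⧸ center G) = 12)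
    {H K : Subgroup (G ⧸ center G)} (hH : H ∈ properCentralizerImages G)
    (hK : K ∈ properCentralizerImages G) (hne : H ≠ K) : Nat.card H * Nat.card K ≤ 12 := by
  obtain ⟨p, hp, rfl⟩ := mem_properCentralizerImages.1 hH
  obtain ⟨q, hq, rfl⟩ := mem_properCentralizerImages.1 hK
  have hdisj : Disjoint (centralizerImage p) (centralizerImage q) := by
    rw [disjoint_def]
    intro u hup huq
    by_contra hu
    exact hne (((centralizerImage_eq_iff h hu hp).2 hup).symm.trans
      ((centralizerImage_eq_iff h hu hq).2 huq))
  rw [← h, ← Nat.card_prod]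
  exact Nat.card_le_card_of_injective _ (mul_injective_of_disjoint hdisj)

theorem even_card_centralizer_of_normal_zpowers {Q : Type*} [Group Q] [Finite Q]
    (hQ : 4 ∣ Nat.card Q) {q : Q} (hq : orderOf q = 3) (hn : (zpowers q).Normal) :
    2 ∣ Nat.card (centralizer {q}) := by
  classical
  have hconj (g : Q) : g * q * g⁻¹ = q ∨ g * q * g⁻¹ = q⁻¹ := by
    have hmem := hn.conj_mem q (mem_zpowers q) g
    have hq3 : q ^ 3 = 1 := hq ▸ pow_orderOf_eq_one q
    rw [mem_zpowers_iff_mem_range_orderOf, hq] at hmem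
    simp only [Finset.mem_image, Finset.mem_range] at hmem
    obtain ⟨k, hk, hkq⟩ := hmem
    interval_cases k
    · have hq1 : q = 1 := by simpa [eq_comm, conj_eq_one_iff] using hkq
      simp [hq1] at hq
    · exact .inl (by simpa using hkq.symm)
    · exact .inr (by rw [← hkq, eq_inv_iff_mul_eq_one, ← pow_succ, hq3])
  have hmem (g : Q) : g ∈ centralizer {q} ↔ g * q * g⁻¹ = q := by
    rw [mem_centralizer_singleton_iff, mul_inv_eq_iff_eq_mul]
  by_cases htop : centralizer {q} = ⊤
  · rw [htop, card_top]
    exact (by norm_num : 2 ∣ 4).trans hQ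
  obtain ⟨a, ha⟩ : ∃ a, a ∉ centralizer {q} := by
    by_contra! hall
    exact htop ((eq_top_iff' _).2 hall)
  have hqq : q⁻¹ ≠ q := fun heq => by
    have hq2 : q ^ 2 = 1 := by rw [sq]; nth_rw 1 [← heq]; simp
    have := orderOf_dvd_of_pow_eq_one hq2
    rw [hq] at this
    omega
  have hainv : a * q * a⁻¹ = q⁻¹ := (hconj a).resolve_left ((hmem a).not.1 ha)
  have hindex : (centralizer {q}).index = 2 := by
    refine index_eq_two_iff.2 ⟨a, fun b => ?_⟩
    have hba : b * a * q * (b * a)⁻¹ = (b * q * b⁻¹)⁻¹ :=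
      calc b * a * q * (b * a)⁻¹ = b * (a * q * a⁻¹) * b⁻¹ := by group
        _ = (b * q * b⁻¹)⁻¹ := by rw [hainv]; group
    rw [hmem, hmem, hba]
    rcases hconj b with hb | hb <;> simp [hb, hqq]
  have := card_mul_index (centralizer {q})
  rw [hindex] at this
  omega

theorem not_normal_zpowers_of_card_centralizerImage (h : Nat.card (G ⧸ center G) = 12)
    {q : G ⧸ center G} (hq : orderOf q = 3) (hcard : Nat.card (centralizerImage q) = 3) :
    ¬ (zpowers q).Normal := by
  intro hn
  have heven := even_card_centralizer_of_normal_zpowers (by rw [h]; norm_num) hq hn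
  have : Fact (Nat.Prime 2) := ⟨Nat.prime_two⟩
  obtain ⟨t, ht⟩ := exists_prime_orderOf_dvd_card' 2 heven
  have ht' : orderOf (t : G ⧸ center G) = 2 := by rw [orderOf_coe, ht]
  have htq : (t : G ⧸ center G) ∈ centralizerImage q :=
    mem_centralizerImage_of_sq_of_cube (mem_centralizer_singleton_iff.1 t.2)
      (ht' ▸ pow_orderOf_eq_one _) (hq ▸ pow_orderOf_eq_one _)
  have hdvd := orderOf_dvd_natCard (⟨t, htq⟩ : centralizerImage q)
  rw [orderOf_mk, ht', hcard] at hdvd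
  omega

theorem centralizerImage_eq_of_card_eq_three (h : Nat.card (G ⧸ center G) = 12)
    (h6 : ∀ H ∈ properCentralizerImages G, Nat.card H ≠ 6) {P : Subgroup (G ⧸ center G)}
    (hP : Nat.card P = 3) {q : G ⧸ center G} (hqP : q ∈ P) (hq : q ≠ 1) :
    zpowers q = P ∧ centralizerImage q = P := by
  have horder : orderOf q = 3 := by
    have hd : orderOf q ∣ 3 := by
      have := orderOf_dvd_natCard (⟨q, hqP⟩ : P)
      rwa [orderOf_mk, hP] at this
    exact ((Nat.dvd_prime Nat.prime_three).1 hd).resolve_left (by simpa using hq)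
  have hz : zpowers q = P := eq_of_le_of_card_ge (zpowers_le.2 hqP)
    (by rw [Nat.card_zpowers, horder, hP])
  have hle : P ≤ centralizerImage q := hz ▸ zpowers_le.2 (self_mem_centralizerImage q)
  have hd := card_dvd_of_le hle
  have hcard := card_centralizerImage h hq
  have hne := h6 _ (mem_properCentralizerImages.2 ⟨q, hq, rfl⟩)
  simp only [Finset.mem_insert, Finset.mem_singleton] at hcard
  rw [hP] at hd
  exact ⟨hz, (eq_of_le_of_card_ge hle (by omega)).symm⟩

theorem card_filter_card_eq_three (h : Nat.card (G ⧸ center G) = 12)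
    (h6 : ∀ H ∈ properCentralizerImages G, Nat.card H ≠ 6) :
    ((properCentralizerImages G).filter
      fun H : Subgroup (G ⧸ center G) => Nat.card H = 3).card = 4 := by
  have : Fact (Nat.Prime 3) := ⟨Nat.prime_three⟩
  have hfact : 3 ^ (Nat.card (G ⧸ center G)).factorization 3 = 3 := by
    have h4 : Nat.factorization 4 3 = 0 := Nat.factorization_eq_zero_of_not_dvd (by norm_num)
    rw [h, show 12 = 4 * 3 by norm_num, Nat.factorization_mul (by norm_num) (by norm_num)]
    simp [h4, Nat.prime_three.factorization_self]
  have hcardP (P : Sylow 3 (G ⧸ center G)) : Nat.card P = 3 := by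
    rw [P.card_eq_multiplicity, hfact]
  have hgen (P : Sylow 3 (G ⧸ center G)) : ∃ q ∈ (P : Subgroup (G ⧸ center G)), q ≠ 1 :=
    (P : Subgroup (G ⧸ center G)).ne_bot_iff_exists_ne_one.1 (fun hbot => by
      have := hcardP P
      rw [hbot, card_bot] at this
      omega) |>.elim fun q hq => ⟨q, q.2, by simpa using hq⟩
  have hcount : ((properCentralizerImages G).filter
      fun H : Subgroup (G ⧸ center G) => Nat.card H = 3).card =
      Nat.card (Sylow 3 (G ⧸ center G)) := by
    rw [← Set.ncard_coe_finset, ← Nat.card_range_of_injective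
      (f := fun P : Sylow 3 (G ⧸ center G) => (P : Subgroup (G ⧸ center G)))
      (fun _ _ => Sylow.ext), Nat.card_coe_set_eq]
    congr 1
    ext H
    simp only [Finset.coe_filter, Set.mem_ofPred_eq, Set.mem_range]
    constructor
    · rintro ⟨-, hH⟩
      exact ⟨Sylow.ofCard H (by rw [hH, hfact]), rfl⟩
    · rintro ⟨P, rfl⟩
      obtain ⟨q, hqP, hq⟩ := hgen P
      exact ⟨mem_properCentralizerImages.2
        ⟨q, hq, (centralizerImage_eq_of_card_eq_three h h6 (hcardP P) hqP hq).2⟩, hcardP P⟩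
  rw [hcount]
  obtain ⟨P⟩ : Nonempty (Sylow 3 (G ⧸ center G)) := inferInstance
  obtain ⟨q, hqP, hq⟩ := hgen P
  obtain ⟨hz, hD⟩ := centralizerImage_eq_of_card_eq_three h h6 (hcardP P) hqP hq
  have hdvd : Nat.card (Sylow 3 (G ⧸ center G)) ∣ 4 := by
    have hindex := card_mul_index (P : Subgroup (G ⧸ center G))
    rw [h, show Nat.card (P : Subgroup (G ⧸ center G)) = 3 from hcardP P] at hindex
    rw [show 4 = (P : Subgroup (G ⧸ center G)).index by omega]
    exact P.card_dvd_index
  have hmod := card_sylow_modEq_one 3 (G ⧸ center G)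
  have hne : Nat.card (Sylow 3 (G ⧸ center G)) ≠ 1 := by
    intro hone
    have : Subsingleton (Sylow 3 (G ⧸ center G)) := (Nat.card_eq_one_iff_unique.1 hone).1
    refine not_normal_zpowers_of_card_centralizerImage h (q := q) ?_ ?_ ?_
    · rw [← Nat.card_zpowers, hz]
      exact hcardP P
    · rw [hD]
      exact hcardP P
    · rw [hz]
      exact Sylow.normal_of_subsingleton P
  have hle := Nat.le_of_dvd (by norm_num) hdvd
  unfold Nat.ModEq at hmod
  omega

theorem card_properCentralizerImages (h : Nat.card (G ⧸ center G) = 12) :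
    (properCentralizerImages G).card = 5 ∨ (properCentralizerImages G).card = 7 := by
  classical
  have hsum := sum_card_sub_one_properCentralizerImages h
  have hcard (H) (hH : H ∈ properCentralizerImages G) :
      Nat.card H = 2 ∨ Nat.card H = 3 ∨ Nat.card H = 4 ∨ Nat.card H = 6 := by
    obtain ⟨q, hq, rfl⟩ := mem_properCentralizerImages.1 hH
    simpa using card_centralizerImage h hq
  by_cases h6 : ∀ H ∈ properCentralizerImages G, Nat.card H ≠ 6
  · have h3 := card_filter_card_eq_three h h6
    have hsplit : ∑ H ∈ properCentralizerImages G, (Nat.card H - 1) =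
        ∑ H ∈ properCentralizerImages G, (1 + (if Nat.card H = 3 then 1 else 0) +
          2 * (if Nat.card H = 4 then 1 else 0)) := by
      refine Finset.sum_congr rfl fun H hH => ?_
      rcases hcard H hH with hc | hc | hc | hc
      all_goals first | exact absurd hc (h6 H hH) | simp [hc]
    have hle := Finset.card_le_card
      (Finset.filter_subset (fun H : Subgroup (G ⧸ center G) => Nat.card H = 3)
        (properCentralizerImages G))
    rw [hsplit, Finset.sum_add_distrib, Finset.sum_add_distrib, ← Finset.mul_sum,
      ← Finset.card_filter, ← Finset.card_filter, h3] at hsum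
    simp only [Finset.sum_const, smul_eq_mul, mul_one] at hsum
    omega
  · push Not at h6
    obtain ⟨H, hH, hH6⟩ := h6
    have hother : ∑ K ∈ (properCentralizerImages G).erase H, (Nat.card K - 1) =
        ∑ K ∈ (properCentralizerImages G).erase H, 1 := by
      refine Finset.sum_congr rfl fun K hK => ?_
      obtain ⟨hne, hK⟩ := Finset.mem_erase.1 hK
      have := card_mul_card_le_of_mem_properCentralizerImages h hH hK hne.symm
      have := hcard K hK
      rw [hH6] at *
      omega
    rw [← Finset.add_sum_erase _ _ hH, hother, hH6, Finset.sum_const,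
      Finset.card_erase_of_mem hH] at hsum
    simp only [smul_eq_mul] at hsum
    omega

end CentralQuotientTwelve

theorem card_cent_of_central_quotient_twelve
    (G : Type*) [Group G] [Finite G]
    (h : Nat.card (G ⧸ Subgroup.center G) = 12) :
    (Cent G).ncard = 6 ∨ (Cent G).ncard = 8 := by
  rw [ncard_cent_eq_card_add_one]
  have := card_properCentralizerImages h
  omega
end

section
/- Let G be a finite group with |G/Z(G)| = p²q for primes p < q with (p,q) ≠ (2,3). Then |Cent(G)| = pq + 2 or q + 2. -/
open Subgroup

theorem Nat.eq_one_or_prime_of_mul_mul_eq_sq_mul {a b c p q : ℕ} (hp : p.Prime) (hq : q.Prime)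
    (h : a * b * c = p ^ 2 * q) (ha : a ≠ 1) (hc : c ≠ 1) : b = 1 ∨ b.Prime := by
  have h0 : a * b * c ≠ 0 := h ▸ mul_ne_zero (pow_ne_zero 2 hp.ne_zero) hq.ne_zero
  have hab := left_ne_zero_of_mul h0
  have hc0 := right_ne_zero_of_mul h0
  have ha0 := left_ne_zero_of_mul hab
  have hb0 := right_ne_zero_of_mul hab
  have hΩ := congrArg ArithmeticFunction.cardFactors h
  rw [ArithmeticFunction.cardFactors_mul hab hc0, ArithmeticFunction.cardFactors_mul ha0 hb0,
    ArithmeticFunction.cardFactors_mul (pow_ne_zero 2 hp.ne_zero) hq.ne_zero,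
    ArithmeticFunction.cardFactors_pow, ArithmeticFunction.cardFactors_apply_prime hp,
    ArithmeticFunction.cardFactors_apply_prime hq] at hΩ
  have hΩa := mt ArithmeticFunction.cardFactors_eq_zero_iff_eq_zero_or_one.mp (not_or.mpr ⟨ha0, ha⟩)
  have hΩc := mt ArithmeticFunction.cardFactors_eq_zero_iff_eq_zero_or_one.mp (not_or.mpr ⟨hc0, hc⟩)
  rcases (by lia : ArithmeticFunction.cardFactors b = 0 ∨ ArithmeticFunction.cardFactors b = 1)
    with hb | hb
  · exact .inl ((ArithmeticFunction.cardFactors_eq_zero_iff_eq_zero_or_one.mp hb).resolve_left hb0)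
  · exact .inr (ArithmeticFunction.cardFactors_eq_one_iff_prime.mp hb)

section

variable {G : Type*} [Group G]

theorem mem_centralizer_singleton_self (x : G) : x ∈ centralizer {x} :=
  mem_centralizer_singleton_iff.mpr rfl

theorem mem_centralizer_singleton_comm {x y : G} :
    x ∈ centralizer {y} ↔ y ∈ centralizer {x} := by
  rw [mem_centralizer_singleton_iff, mem_centralizer_singleton_iff, eq_comm]

theorem centralizer_singleton_eq_top_iff {x : G} : centralizer {x} = ⊤ ↔ x ∈ center G := by
  rw [centralizer_eq_top_iff_subset, Set.singleton_subset_iff, SetLike.mem_coe]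

/-- If `Z(G)` has index `p ^ 2 * q`, then every proper element centralizer is abelian. -/
theorem commute_of_mem_centralizer {p q : ℕ} (hp : p.Prime) (hq : q.Prime)
    (h : (center G).index = p ^ 2 * q) {x : G} (hx : x ∉ center G) {a b : G}
    (ha : a ∈ centralizer {x}) (hb : b ∈ centralizer {x}) : a * b = b * a := by
  set H : Subgroup G := centralizer {x}
  set W : Subgroup G := (center H).map H.subtype
  have hWH : W ≤ H := map_subtype_le _
  have hZW : center G ≤ W := fun z hz ↦
    ⟨⟨z, center_le_centralizer _ hz⟩,
      mem_center_iff.mpr fun g ↦ Subtype.ext (mem_center_iff.mp hz g), rfl⟩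
  have hxW : x ∈ W := ⟨⟨x, mem_centralizer_singleton_self x⟩,
    mem_center_iff.mpr fun g ↦ Subtype.ext (mem_centralizer_singleton_iff.mp g.2), rfl⟩
  have hindex : W.relIndex H = (center H).index := by
    rw [relIndex, subgroupOf, comap_map_eq_self_of_injective H.subtype_injective]
  have hprod : (center G).relIndex W * W.relIndex H * H.index = p ^ 2 * q := by
    rw [relIndex_mul_relIndex _ _ _ hZW hWH, relIndex_mul_index (hZW.trans hWH), h]
  have hcomm : ∀ a b : H, a * b = b * a := by
    rcases Nat.eq_one_or_prime_of_mul_mul_eq_sq_mul hp hq hprod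
      (fun h1 ↦ hx (relIndex_eq_one.mp h1 hxW))
      (fun h1 ↦ hx (centralizer_singleton_eq_top_iff.mp (index_eq_one.mp h1))) with h1 | h1
    · rw [hindex, index_eq_one] at h1
      intro a b
      exact (mem_center_iff.mp (h1 ▸ mem_top a : a ∈ center H) b).symm
    · rw [hindex] at h1
      have : Fact (center H).index.Prime := ⟨h1⟩
      have : IsCyclic (H ⧸ center H) := isCyclic_of_prime_card (p := (center H).index) rfl
      exact ((QuotientGroup.mk' (center H)).isMulCommutative_of_isCyclic_of_ker_le_center
        (QuotientGroup.ker_mk' _).le).is_comm.comm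
  exact congrArg Subtype.val (hcomm ⟨a, ha⟩ ⟨b, hb⟩)

theorem centralizer_eq_of_mem_centralizer {p q : ℕ} (hp : p.Prime) (hq : q.Prime)
    (h : (center G).index = p ^ 2 * q) {x z : G} (hx : x ∉ center G) (hz : z ∉ center G)
    (hzx : z ∈ centralizer {x}) : centralizer {z} = centralizer {x} := by
  have key : ∀ {x z : G}, x ∉ center G → z ∈ centralizer {x} → centralizer {x} ≤ centralizer {z} :=
    fun hx hzx a ha ↦
      mem_centralizer_singleton_iff.mpr (commute_of_mem_centralizer hp hq h hx ha hzx)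
  exact le_antisymm (key hz (mem_centralizer_singleton_comm.mp hzx)) (key hx hzx)

/-- If the proper centralizers meet pairwise in the center and all of them other than `C(x)` have
the same relative order, complementary to that of `C(x)`, then there are `[C(x) : Z(G)] + 2`
centralizers in total. -/
theorem ncard_cent_of_card_centralizer_mul [Finite G]
    (hpart : ∀ y z : G, y ∉ center G → z ∉ center G → z ∈ centralizer {y} →
      centralizer {z} = centralizer {y})
    {x : G} (hx : x ∉ center G)
    (hcard : ∀ y ∉ centralizer {x},
      (center G).relIndex (centralizer {y}) = (centralizer {x}).index) :
    (Cent G).ncard = (center G).relIndex (centralizer {x}) + 2 := by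
  classical
  have := Fintype.ofFinite G
  set K : Subgroup G := centralizer {x} with hK
  have hZK : center G ≤ K := center_le_centralizer _
  set S : Finset G := Finset.univ.filter (· ∉ K) with hS
  set T : Finset (Subgroup G) := S.image fun y ↦ centralizer {y} with hT
  have hout : ∀ y ∉ K, y ∉ center G := fun y hy hyc ↦ hy (hZK hyc)
  have hKtop : K ≠ ⊤ := fun h1 ↦ hx (centralizer_singleton_eq_top_iff.mp h1)
  have hcardZ : ∀ H : Subgroup G, center G ≤ H →
      Nat.card H = Nat.card (center G) * (center G).relIndex H := fun H hH ↦ by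
    rw [← relIndex_bot_left, ← relIndex_bot_left, relIndex_mul_relIndex _ _ _ bot_le hH]
  have hfiber : ∀ H ∈ T,
      (S.filter fun y ↦ centralizer {y} = H).card = Nat.card (center G) * (K.index - 1) := by
    intro H hH
    obtain ⟨y, hy, rfl⟩ := Finset.mem_image.mp hH
    have hyK : y ∉ K := (Finset.mem_filter.mp hy).2
    have hset : S.filter (fun g ↦ centralizer {g} = centralizer {y}) =
        ((centralizer {y} : Subgroup G) : Set G).toFinset \ (center G : Set G).toFinset := by
      ext g
      simp only [hS, Finset.mem_filter, Finset.mem_univ, true_and, Finset.mem_sdiff,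
        Set.mem_toFinset, SetLike.mem_coe]
      constructor
      · rintro ⟨hgK, hgy⟩
        exact ⟨hgy ▸ mem_centralizer_singleton_self g, hout g hgK⟩
      · rintro ⟨hgy, hgc⟩
        have hgeq := hpart y g (hout y hyK) hgc hgy
        refine ⟨fun hgK ↦ hyK ?_, hgeq⟩
        rw [hK, ← hpart x g hx hgc hgK, hgeq]
        exact mem_centralizer_singleton_self y
    have hle : center G ≤ centralizer {y} := center_le_centralizer _
    rw [hset, Finset.card_sdiff_of_subset (by simpa using hle), Set.toFinset_card,
      Set.toFinset_card, ← Nat.card_eq_fintype_card, ← Nat.card_eq_fintype_card,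
      Nat.mul_sub_one, ← hcard y hyK]
    exact congrArg (· - _) (hcardZ _ hle)
  have hScard : S.card = Nat.card K * (K.index - 1) := by
    have hset : S = Finset.univ \ (K : Set G).toFinset := by
      ext g
      simp [hS]
    rw [hset, Finset.card_sdiff_of_subset (Finset.subset_univ _), Set.toFinset_card,
      ← Nat.card_eq_fintype_card, Finset.card_univ, ← Nat.card_eq_fintype_card, Nat.mul_sub_one,
      card_mul_index]
    rfl
  have hTcard : T.card = (center G).relIndex K := by
    have hsum := Finset.card_eq_sum_card_image (fun y : G ↦ centralizer {y}) S
    rw [Finset.sum_congr rfl hfiber, Finset.sum_const, smul_eq_mul, hScard, hcardZ K hZK] at hsum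
    have hidx : 1 < K.index := by
      have h0 : K.index ≠ 0 := index_ne_zero_of_finite
      have h1 : K.index ≠ 1 := mt index_eq_one.mp hKtop
      lia
    have hpos : 0 < Nat.card (center G) * (K.index - 1) :=
      Nat.mul_pos Nat.card_pos (by lia)
    refine Nat.eq_of_mul_eq_mul_right hpos ?_
    rw [← hsum]
    ring
  have hKT : K ∉ T := by
    intro hmem
    obtain ⟨y, hy, hyK⟩ := Finset.mem_image.mp hmem
    exact (Finset.mem_filter.mp hy).2 (hyK ▸ mem_centralizer_singleton_self y)
  have htopT : ⊤ ∉ insert K T := by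
    rw [Finset.mem_insert, not_or]
    refine ⟨hKtop.symm, fun hmem ↦ ?_⟩
    obtain ⟨y, hy, hytop⟩ := Finset.mem_image.mp hmem
    exact hout y (Finset.mem_filter.mp hy).2 (centralizer_singleton_eq_top_iff.mp hytop)
  have hCent : Cent G = ((insert ⊤ (insert K T) : Finset (Subgroup G)) : Set (Subgroup G)) := by
    ext H
    simp only [Cent, Set.mem_ofPred_eq, Finset.mem_coe, Finset.mem_insert]
    constructor
    · rintro ⟨y, rfl⟩
      by_cases hyc : y ∈ center G
      · exact .inl (centralizer_singleton_eq_top_iff.mpr hyc)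
      · by_cases hyK : y ∈ K
        · exact .inr (.inl (hpart x y hx hyc hyK))
        · exact .inr (.inr (Finset.mem_image_of_mem _
            (Finset.mem_filter.mpr ⟨Finset.mem_univ _, hyK⟩)))
    · rintro (rfl | rfl | hmem)
      · exact ⟨1, (centralizer_singleton_eq_top_iff.mpr (one_mem _)).symm⟩
      · exact ⟨x, rfl⟩
      · obtain ⟨y, -, rfl⟩ := Finset.mem_image.mp hmem
        exact ⟨y, rfl⟩
  rw [hCent, Set.ncard_coe_finset, Finset.card_insert_of_notMem htopT,
    Finset.card_insert_of_notMem hKT, hTcard]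

theorem pow_eq_one_of_mul_eq_mul_mul {g x z : G} {n : ℕ} (hz : z ∈ center G)
    (hgx : g * x = z * x * g) (hx : x ^ n ∈ center G) : z ^ n = 1 := by
  have hzx : Commute z x := (mem_center_iff.mp hz x).symm
  have hpow : g * x ^ n = (z * x) ^ n * g :=
    SemiconjBy.pow_right (show SemiconjBy g x (z * x) from hgx) n
  rw [mem_center_iff.mp hx g, hzx.mul_pow, mul_left_inj] at hpow
  exact right_eq_mul.mp hpow

/-- Elements that commute modulo the center and have coprime orders there commute. -/
theorem commute_of_coprime_pow_mem_center {g x : G} {m n : ℕ} (hmn : m.Coprime n)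
    (hgx : g * x * g⁻¹ * x⁻¹ ∈ center G) (hg : g ^ m ∈ center G) (hx : x ^ n ∈ center G) :
    g * x = x * g := by
  set z := g * x * g⁻¹ * x⁻¹ with hzdef
  have hgx' : g * x = z * x * g := by rw [hzdef]; group
  have hn : z ^ n = 1 := pow_eq_one_of_mul_eq_mul_mul hgx hgx' hx
  have hxg : x * g = z⁻¹ * g * x := by rw [hzdef]; group
  have hm : z⁻¹ ^ m = 1 := pow_eq_one_of_mul_eq_mul_mul (inv_mem hgx) hxg hg
  rw [inv_pow, inv_eq_one] at hm
  have hz : z = 1 := by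
    rw [← pow_one z, ← Nat.Coprime.gcd_eq_one hmn, pow_gcd_eq_one]
    exact ⟨hm, hn⟩
  rw [hxg, hz, inv_one, one_mul]

end

theorem Sylow.normal_of_card_eq_sq_mul {Q : Type*} [Group Q] [Finite Q] {p q : ℕ}
    (hp : p.Prime) [hq : Fact q.Prime] (hpq : p < q) (hne : ¬ (p = 2 ∧ q = 3))
    (h : Nat.card Q = p ^ 2 * q) (N : Sylow q Q) :
    Nat.card N = q ∧ (N : Subgroup Q).Normal := by
  have hcop : Nat.Coprime (p ^ 2) q :=
    Nat.Coprime.pow_left 2 ((Nat.coprime_primes hp hq.out).mpr hpq.ne)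
  have hcard : Nat.card N = q := by
    have hfac : (p ^ 2 * q).factorization q = 1 := by
      rw [Nat.factorization_mul (pow_ne_zero 2 hp.ne_zero) hq.out.ne_zero, Finsupp.add_apply,
        hq.out.factorization_self, Nat.factorization_eq_zero_of_not_dvd]
      intro hdvd
      exact hpq.ne' ((Nat.prime_dvd_prime_iff_eq hq.out hp).mp (hq.out.dvd_of_dvd_pow hdvd))
    rw [N.card_eq_multiplicity, h, hfac, pow_one]
  have hindex : (N : Subgroup Q).index = p ^ 2 := by
    have := (N : Subgroup Q).card_mul_index
    rw [h, hcard, mul_comm] at this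
    exact Nat.eq_of_mul_eq_mul_right hq.out.pos this
  have hmod := card_sylow_modEq_one q Q
  have hdvd := N.card_dvd_index
  rw [hindex, Nat.dvd_prime_pow hp] at hdvd
  obtain ⟨k, hk, hcardk⟩ := hdvd
  have hq_dvd : (q : ℤ) ∣ (p ^ k : ℕ) - 1 := by
    rw [hcardk] at hmod
    exact_mod_cast hmod.symm.dvd
  have hone : Nat.card (Sylow q Q) = 1 := by
    have hp2 := hp.two_le
    interval_cases k
    · simpa using hcardk
    · exfalso
      have := Int.le_of_dvd (by push_cast; lia) hq_dvd
      push_cast at this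
      lia
    · exfalso
      have hprod : (q : ℤ) ∣ (p + 1) * (p - 1) := by
        convert hq_dvd using 1
        push_cast
        ring
      rcases (Nat.prime_iff_prime_int.mp hq.out).dvd_or_dvd hprod with h1 | h1
      · have hqp : q = p + 1 := by
          have := Int.le_of_dvd (by lia) h1
          lia
        rcases hp.eq_two_or_odd with h2 | h2
        · exact hne ⟨h2, by lia⟩
        · rcases hq.out.eq_two_or_odd with h3 | h3 <;> lia
      · have := Int.le_of_dvd (by lia) h1
        lia
  have := (Nat.card_eq_one_iff_unique.mp hone).1
  exact ⟨hcard, N.normal_of_subsingleton⟩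

section

variable {G : Type*} [Group G]

theorem normal_centralizer_of_normal_zpowers {x : G}
    (hN : (zpowers (x : G ⧸ center G)).Normal) : (centralizer {x}).Normal := by
  refine ⟨fun k hk g ↦ ?_⟩
  obtain ⟨j, hj⟩ := mem_zpowers_iff.mp (hN.conj_mem _ (mem_zpowers (x : G ⧸ center G)) (g⁻¹ : G))
  have hz : (x ^ j)⁻¹ * (g⁻¹ * x * g) ∈ center G := by
    rw [← QuotientGroup.eq]
    simpa using hj
  have hkx : Commute k x := mem_centralizer_singleton_iff.mp hk
  have hkconj : Commute k (g⁻¹ * x * g) := by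
    have hkz : Commute k ((x ^ j)⁻¹ * (g⁻¹ * x * g)) := mem_center_iff.mp hz k
    simpa using (hkx.zpow_right j).mul_right hkz
  rw [mem_centralizer_singleton_iff]
  have := congrArg (fun t ↦ g * t * g⁻¹) hkconj.eq
  simpa [mul_assoc] using this

theorem isCyclic_sylow_of_map_centralizer_eq_zpowers [Finite G] {p q : ℕ} [hp : Fact p.Prime]
    [hq : Fact q.Prime] (hpq : p ≠ q) {x : G} (hord : orderOf (x : G ⧸ center G) = q)
    (hN : (zpowers (x : G ⧸ center G)).Normal)
    (hK : (centralizer {x}).map (QuotientGroup.mk' (center G)) = zpowers (x : G ⧸ center G))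
    (P : Sylow p (G ⧸ center G)) : IsCyclic P := by
  set N := zpowers (x : G ⧸ center G) with hNdef
  have hNcard : Nat.card N = q := by rw [hNdef, Nat.card_zpowers, hord]
  have : IsCyclic (MulAut N) := by
    have e := IsCyclic.mulAutMulEquiv N
    rw [hNcard] at e
    exact isCyclic_of_injective e.toMonoidHom e.injective
  refine isCyclic_of_injective
    ((MulAut.conjNormal (H := N)).comp (P : Subgroup (G ⧸ center G)).subtype) ?_
  rw [injective_iff_map_eq_one]
  rintro ⟨g, hg⟩ hg1
  obtain ⟨n, hn⟩ := P.isPGroup' ⟨g, hg⟩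
  have hcop : (p ^ n).Coprime q :=
    Nat.Coprime.pow_left n ((Nat.coprime_primes hp.out hq.out).mpr hpq)
  have hgn : g ^ p ^ n = 1 := congrArg Subtype.val hn
  obtain ⟨g, rfl⟩ := QuotientGroup.mk_surjective g
  have hconj : (g : G ⧸ center G) * x * (g : G ⧸ center G)⁻¹ = x := by
    have hxN : (x : G ⧸ center G) ∈ N := mem_zpowers _
    simpa using congrArg Subtype.val (DFunLike.congr_fun hg1 ⟨_, hxN⟩)
  have hgx : g * x = x * g := by
    refine commute_of_coprime_pow_mem_center hcop ?_ ?_ (n := q) ?_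
    · rw [← QuotientGroup.eq_one_iff]
      simpa [mul_inv_eq_one] using hconj
    · rw [← QuotientGroup.eq_one_iff]
      exact_mod_cast hgn
    · rw [← QuotientGroup.eq_one_iff, QuotientGroup.mk_pow, ← hord, pow_orderOf_eq_one]
  have hgN : (g : G ⧸ center G) ∈ N := by
    rw [← hK]
    exact ⟨g, mem_centralizer_singleton_iff.mpr hgx, rfl⟩
  have hgq : (g : G ⧸ center G) ^ q = 1 := by
    have := pow_card_eq_one' (x := (⟨g, hgN⟩ : N))
    rw [hNcard] at this
    exact congrArg Subtype.val this
  refine Subtype.ext (?_ : (g : G ⧸ center G) = 1)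
  rw [← pow_one (g : G ⧸ center G), ← Nat.Coprime.gcd_eq_one hcop, pow_gcd_eq_one]
  exact ⟨hgn, hgq⟩

/-- A cyclic subgroup of `G ⧸ Z(G)` containing the image of `C(y)` is contained in it. -/
theorem le_map_centralizer_of_isCyclic {y : G} {P : Subgroup (G ⧸ center G)} (hP : IsCyclic P)
    (hle : (centralizer {y}).map (QuotientGroup.mk' (center G)) ≤ P) :
    P ≤ (centralizer {y}).map (QuotientGroup.mk' (center G)) := by
  obtain ⟨g, hgen⟩ := (Subgroup.isCyclic_iff_exists_zpowers_eq_top P).mp hP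
  obtain ⟨g, rfl⟩ := QuotientGroup.mk_surjective g
  replace hgen := hgen.symm
  have hy : (y : G ⧸ center G) ∈ P := hle ⟨y, mem_centralizer_singleton_self y, rfl⟩
  rw [hgen] at hy
  obtain ⟨j, hj⟩ := mem_zpowers_iff.mp hy
  have hz : (g ^ j)⁻¹ * y ∈ center G := by
    rw [← QuotientGroup.eq]
    simpa using hj
  have hgy : Commute g y := by
    have hgz : Commute g ((g ^ j)⁻¹ * y) := mem_center_iff.mp hz g
    simpa using ((Commute.refl g).zpow_right j).mul_right hgz
  rw [hgen, zpowers_le]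
  exact ⟨g, mem_centralizer_singleton_iff.mpr hgy, rfl⟩

end

theorem card_cent_of_central_quotient_p_sq_q
    (G : Type*) [Group G] [Finite G] (p q : ℕ)
    (hp : p.Prime) (hq : q.Prime) (hpq : p < q)
    (hne : ¬ (p = 2 ∧ q = 3))
    (h : Nat.card (G ⧸ Subgroup.center G) = p ^ 2 * q) :
    (Cent G).ncard = p * q + 2 ∨ (Cent G).ncard = q + 2 := by
  have : Fact p.Prime := ⟨hp⟩
  have : Fact q.Prime := ⟨hq⟩
  obtain ⟨N⟩ : Nonempty (Sylow q (G ⧸ center G)) := inferInstance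
  obtain ⟨hNcard, hNnormal⟩ := N.normal_of_card_eq_sq_mul hp hpq hne h
  obtain ⟨x, hNx⟩ : ∃ x : G, (N : Subgroup _) = zpowers (x : G ⧸ center G) := by
    have : IsCyclic N := isCyclic_of_prime_card hNcard
    obtain ⟨n, hn⟩ := (Subgroup.isCyclic_iff_exists_zpowers_eq_top _).mp this
    obtain ⟨x, rfl⟩ := QuotientGroup.mk_surjective n
    exact ⟨x, hn.symm⟩
  rw [hNx] at hNnormal
  have hord : orderOf (x : G ⧸ center G) = q := by
    rw [← Nat.card_zpowers, ← hNx]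
    exact hNcard
  have hx : x ∉ center G := fun hxc ↦ hq.ne_one <| by
    rw [← hord, (QuotientGroup.eq_one_iff x).mpr hxc, orderOf_one]
  have hindex : (center G).index = p ^ 2 * q := h
  have hmap : ∀ H : Subgroup G,
      Nat.card (H.map (QuotientGroup.mk' (center G))) = (center G).relIndex H := fun H ↦ by
    rw [← relIndex_ker, QuotientGroup.ker_mk']
  have hpart : ∀ y z : G, y ∉ center G → z ∉ center G → z ∈ centralizer {y} →
      centralizer {z} = centralizer {y} :=
    fun _ _ hy hz hzy ↦ centralizer_eq_of_mem_centralizer hp hq hindex hy hz hzy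
  have hKnormal := normal_centralizer_of_normal_zpowers hNnormal
  have hNle : zpowers (x : G ⧸ center G) ≤
      (centralizer {x}).map (QuotientGroup.mk' (center G)) :=
    zpowers_le.mpr ⟨x, mem_centralizer_singleton_self x, rfl⟩
  have hmul := relIndex_mul_index (center_le_centralizer {x})
  rw [hindex] at hmul
  obtain ⟨t, ht⟩ : q ∣ (center G).relIndex (centralizer {x}) := by
    rw [← hmap, ← hord, ← Nat.card_zpowers]
    exact card_dvd_of_le hNle
  have htp : t * (centralizer {x}).index = p ^ 2 :=
    Nat.eq_of_mul_eq_mul_right hq.pos (by rw [← hmul, ht]; ring)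
  have hdvd : ∀ y ∉ centralizer {x},
      (center G).relIndex (centralizer {y}) ∣ (centralizer {x}).index := by
    intro y hy
    have hyc : y ∉ center G := fun hyc ↦ hy (center_le_centralizer _ hyc)
    have hinf : centralizer {x} ⊓ centralizer {y} = center G := by
      refine le_antisymm (fun z hz ↦ ?_)
        (le_inf (center_le_centralizer _) (center_le_centralizer _))
      by_contra hzc
      refine hy ?_
      rw [← hpart x z hx hzc hz.1, hpart y z hyc hzc hz.2]
      exact mem_centralizer_singleton_self y
    rw [← hinf, inf_relIndex_right]
    exact relIndex_dvd_index_of_normal _ _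
  have hne_one : ∀ y ∉ centralizer {x}, (center G).relIndex (centralizer {y}) ≠ 1 :=
    fun y hy h1 ↦ hy (center_le_centralizer _
      (relIndex_eq_one.mp h1 (mem_centralizer_singleton_self y)))
  obtain ⟨k, hk, hKk⟩ := (Nat.dvd_prime_pow hp).mp (Dvd.intro_left t htp)
  interval_cases k
  · rw [pow_zero, index_eq_one] at hKk
    exact absurd (centralizer_singleton_eq_top_iff.mp hKk) hx
  · rw [pow_one] at hKk
    left
    rw [ncard_cent_of_card_centralizer_mul hpart hx, ht]
    · rw [hKk, sq] at htp
      rw [Nat.eq_of_mul_eq_mul_right hp.pos htp, mul_comm]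
    · intro y hy
      have := hdvd y hy
      rw [hKk] at this ⊢
      exact ((Nat.dvd_prime hp).mp this).resolve_left (hne_one y hy)
  · right
    have ht1 : t = 1 := by
      rw [hKk] at htp
      exact (Nat.mul_eq_right (pow_ne_zero 2 hp.ne_zero)).mp htp
    rw [ht1, mul_one] at ht
    have hK : (centralizer {x}).map (QuotientGroup.mk' (center G)) =
        zpowers (x : G ⧸ center G) := by
      refine (eq_of_le_of_card_ge hNle ?_).symm
      rw [hmap, ht, Nat.card_zpowers, hord]
    rw [ncard_cent_of_card_centralizer_mul hpart hx, ht]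
    intro y hy
    have hy_dvd := hdvd y hy
    rw [hKk] at hy_dvd ⊢
    have hpgroup : IsPGroup p ((centralizer {y}).map (QuotientGroup.mk' (center G))) := by
      obtain ⟨j, -, hj⟩ := (Nat.dvd_prime_pow hp).mp hy_dvd
      exact IsPGroup.of_card ((hmap _).trans hj)
    obtain ⟨P, hP⟩ := hpgroup.exists_le_sylow
    have hcyc := isCyclic_sylow_of_map_centralizer_eq_zpowers hpq.ne hord hNnormal hK P
    refine Nat.dvd_antisymm hy_dvd ?_
    rw [← hmap]
    refine (P.pow_dvd_card_of_pow_dvd_card (h ▸ Dvd.intro q rfl)).trans ?_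
    exact card_dvd_of_le (le_map_centralizer_of_isCyclic hcyc hP)
end

section
/- Let G be a finite group with |G/Z(G)| = pq² for primes p < q. Then |Cent(G)| = q² + 2 or q² + q + 2. -/
namespace Subgroup

open scoped commutatorElement

variable {G : Type*} [Group G]

theorem le_of_relIndex_prime {K A L : Subgroup G} (hKA : K ≤ A) (hp : (K.relIndex A).Prime)
    {x : G} (hxA : x ∈ A) (hxK : x ∉ K) (hKL : K ≤ L) (hxL : x ∈ L) : A ≤ L := by
  have hmul := relIndex_mul_relIndex K (A ⊓ L) A (le_inf hKA hKL) inf_le_left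
  rcases (Nat.dvd_prime hp).mp (Dvd.intro_left _ hmul) with h | h
  · exact (relIndex_eq_one.mp h).trans inf_le_right
  · have h1 : K.relIndex (A ⊓ L) = 1 := by
      rw [h] at hmul
      exact Nat.eq_of_mul_eq_mul_right hp.pos (by rw [hmul, one_mul])
    exact absurd (relIndex_eq_one.mp h1 ⟨hxA, hxL⟩) hxK

theorem relIndex_eq_of_lt_of_lt {K A L : Subgroup G} {q : ℕ} (hq : q.Prime) (hKA : K < A)
    (hAL : A < L) (h : K.relIndex L = q ^ 2) : K.relIndex A = q ∧ A.relIndex L = q := by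
  have hmul := relIndex_mul_relIndex K A L hKA.le hAL.le
  rw [h] at hmul
  have h1 : K.relIndex A ≠ 1 := fun h => hKA.not_ge (relIndex_eq_one.mp h)
  have h2 : A.relIndex L ≠ 1 := fun h => hAL.not_ge (relIndex_eq_one.mp h)
  exact (hq.mul_eq_prime_sq_iff h1 h2).mp hmul

theorem mem_centralizer_comm {x y : G} :
    x ∈ centralizer {y} ↔ y ∈ centralizer {x} := by
  simp only [mem_centralizer_singleton_iff]
  exact eq_comm

theorem self_mem_centralizer (x : G) : x ∈ centralizer {x} :=
  mem_centralizer_singleton_iff.mpr rfl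

theorem centralizer_eq_top_iff_mem_center {x : G} :
    centralizer {x} = ⊤ ↔ x ∈ center G := by
  rw [centralizer_eq_top_iff_subset, Set.singleton_subset_iff, SetLike.mem_coe]

theorem le_centralizer_of_relIndex_center_prime {A : Subgroup G} (hA : center G ≤ A)
    (hp : ((center G).relIndex A).Prime) {x : G} (hx : x ∈ A) : A ≤ centralizer {x} := by
  by_cases hxZ : x ∈ center G
  · rw [centralizer_eq_top_iff_mem_center.mpr hxZ]
    exact le_top
  · exact le_of_relIndex_prime hA hp hx hxZ (center_le_centralizer _) (self_mem_centralizer x)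

theorem mem_center_of_le_centralizer_of_index_prime {N : Subgroup G} (hp : N.index.Prime)
    {x y : G} (hN : N ≤ centralizer {x}) (hy : y ∉ N) (hxy : y ∈ centralizer {x}) :
    x ∈ center G := by
  rw [← centralizer_eq_top_iff_mem_center, eq_top_iff]
  exact le_of_relIndex_prime le_top (by rwa [relIndex_top_right]) (mem_top y) hy hN hxy

theorem commute_of_mem_of_le_centralizer {N : Subgroup G} {q : ℕ} (hq : q.Prime)
    (hZN : center G ≤ N) (hrel : (center G).relIndex N = q ^ 2) {x : G} (hx : x ∈ N)
    (hxZ : x ∉ center G) (hN : N ≤ centralizer {x}) {u : G} (hu : u ∈ N) :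
    N ≤ centralizer {u} := by
  set E := centralizer (N : Set G) ⊓ N with hE
  have hxE : x ∈ E := ⟨mem_centralizer_iff.mpr fun y hy =>
    mem_centralizer_singleton_iff.mp (hN hy), hx⟩
  have hZE : center G < E :=
    lt_of_le_of_ne (le_inf (center_le_centralizer _) hZN) fun h => hxZ (h ▸ hxE)
  have key : u ∈ E := by
    by_contra huE
    have hEN : E < N := lt_of_le_of_ne inf_le_right fun h => huE (h ▸ hu)
    have h2 := (relIndex_eq_of_lt_of_lt hq hZE hEN hrel).2
    have : N ≤ centralizer {u} := by
      refine le_of_relIndex_prime hEN.le (h2 ▸ hq) hu huE (fun v hv => ?_) (self_mem_centralizer u)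
      exact mem_centralizer_singleton_iff.mpr (mem_centralizer_iff.mp hv.1 u hu).symm
    exact huE ⟨mem_centralizer_iff.mpr fun y hy =>
      mem_centralizer_singleton_iff.mp (this hy), hu⟩
  exact fun v hv => mem_centralizer_singleton_iff.mpr (mem_centralizer_iff.mp key.1 v hv)

theorem relIndex_centralizer_inf {N : Subgroup G} {q : ℕ} (hq : q.Prime)
    (hZN : center G ≤ N) (hrel : (center G).relIndex N = q ^ 2) {x : G} (hx : x ∈ N)
    (hxZ : x ∉ center G) (hN : ¬ N ≤ centralizer {x}) :
    (center G).relIndex (centralizer {x} ⊓ N) = q ∧ (centralizer {x} ⊓ N).relIndex N = q := by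
  refine relIndex_eq_of_lt_of_lt hq
    (lt_of_le_of_ne (le_inf (center_le_centralizer _) hZN) fun h => hxZ ?_)
    (lt_of_le_of_ne inf_le_right fun h => hN ?_) hrel
  · rw [h]
    exact ⟨self_mem_centralizer x, hx⟩
  · rw [← h]
    exact inf_le_left

theorem commute_commutatorElement_of_commute {x w y : G} (hc : ⁅x, w⁆ ∈ center G)
    (hxy : Commute x y) : Commute x ⁅y, w⁆ := by
  have hw : x * w * x⁻¹ = ⁅x, w⁆ * w := by simp [commutatorElement_def]
  have h := mem_center_iff.mp hc
  generalize ⁅x, w⁆ = c at hw h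
  have hv : x * (y * w * y⁻¹) * x⁻¹ = c * (y * w * y⁻¹) :=
    calc x * (y * w * y⁻¹) * x⁻¹ = x * y * w * (x * y)⁻¹ := by group
      _ = y * (x * w * x⁻¹) * y⁻¹ := by rw [hxy.eq]; group
      _ = c * (y * w * y⁻¹) := by rw [hw, ← mul_assoc, h y]; group
  refine mul_inv_eq_iff_eq_mul.mp ?_
  calc x * ⁅y, w⁆ * x⁻¹ = (x * (y * w * y⁻¹) * x⁻¹) * (x * w * x⁻¹)⁻¹ := by
        rw [commutatorElement_def]; group
    _ = c * ⁅y, w⁆ * c⁻¹ := by rw [hv, hw, commutatorElement_def]; group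
    _ = ⁅y, w⁆ := by rw [← h, mul_inv_cancel_right]

theorem pow_mul_pow_of_swap {y w a : G} (ha : Commute y a) (h : y * w = a * (w * y)) (n : ℕ) :
    y ^ n * w = a ^ n * (w * y ^ n) := by
  induction n with
  | zero => simp
  | succ n ih =>
    rw [pow_succ' y, mul_assoc, ih, ← mul_assoc, (ha.pow_right n).eq, mul_assoc, ← mul_assoc y, h,
      pow_succ a]
    simp only [mul_assoc]

theorem _root_.eq_one_of_pow_eq_one_of_coprime_s16 {H : Type*} [Group H] {a : H} {m n : ℕ}
    (hmn : m.Coprime n) (hm : a ^ m = 1) (hn : a ^ n = 1) : a = 1 :=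
  orderOf_eq_one_iff.mp (Nat.dvd_one.mp (hmn ▸ Nat.dvd_gcd (orderOf_dvd_of_pow_eq_one hm)
    (orderOf_dvd_of_pow_eq_one hn)))

theorem mem_of_pow_mem_of_coprime {N : Subgroup G} [N.Normal] {a : G} {m n : ℕ}
    (hmn : m.Coprime n) (hm : a ^ m ∈ N) (hn : a ^ n ∈ N) : a ∈ N := by
  rw [← QuotientGroup.eq_one_iff] at *
  exact eq_one_of_pow_eq_one_of_coprime_s16 hmn hm hn

theorem not_commute_of_mem_of_notMem {N : Subgroup G} [N.Normal] {p q : ℕ} (hp : p.Prime)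
    (hq : q.Prime) (hpq : p ≠ q) (hZN : center G ≤ N) (hidx : N.index = p)
    (hrel : (center G).relIndex N = q ^ 2) (hcomm : ∀ a ∈ N, ∀ b ∈ N, ⁅a, b⁆ ∈ center G)
    {x y : G} (hx : x ∈ N) (hxZ : x ∉ center G) (hy : y ∉ N) : ¬ Commute x y := by
  intro hxy
  have hcop : p.Coprime (q ^ 2) := ((Nat.coprime_primes hp hq).mpr hpq).pow_right 2
  have hpowN : ∀ a ∈ N, a ^ q ^ 2 ∈ center G := fun a ha => by
    have := pow_index_mem ((center G).subgroupOf N) ⟨a, ha⟩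
    rwa [← relIndex, hrel, mem_subgroupOf] at this
  by_cases hN : N ≤ centralizer {x}
  · exact hxZ (mem_center_of_le_centralizer_of_index_prime (hidx ▸ hp) hN hy
      (mem_centralizer_singleton_iff.mpr hxy.symm.eq))
  obtain ⟨hA, hAN⟩ := relIndex_centralizer_inf hq hZN hrel hx hxZ hN
  obtain ⟨w, hw, hwx⟩ := SetLike.not_le_iff_exists.mp hN
  set A := centralizer {x} ⊓ N with hAdef
  have hZA : center G ≤ A := le_inf (center_le_centralizer _) hZN
  have hAC : ∀ z, Commute x z → A ≤ centralizer {z} := fun z hz =>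
    le_of_relIndex_prime hZA (hA ▸ hq) ⟨self_mem_centralizer x, hx⟩ hxZ
      (center_le_centralizer _) (mem_centralizer_singleton_iff.mpr hz.eq)
  set z := y ^ q ^ 2 with hz
  have hxz : Commute x z := hxy.pow_right _
  have hzN : z ∉ N := fun h => hy (mem_of_pow_mem_of_coprime hcop (hidx ▸ pow_index_mem N y) h)
  have hzp : z ^ p ∈ center G := by
    rw [hz, ← pow_mul, mul_comm, pow_mul]
    exact hpowN _ (hidx ▸ pow_index_mem N y)
  set a := ⁅z, w⁆ with ha
  have haN : a ∈ N := by
    rw [ha, commutatorElement_def]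
    exact mul_mem (Normal.conj_mem inferInstance w hw z) (inv_mem hw)
  have haA : a ∈ A := ⟨mem_centralizer_singleton_iff.mpr
    (commute_commutatorElement_of_commute (hcomm x hx w hw) hxz).symm.eq, haN⟩
  have haz : Commute a z := mem_centralizer_singleton_iff.mp (hAC z hxz haA)
  have hswap : z * w = a * (w * z) := by rw [ha, commutatorElement_def]; group
  have hap : a ^ p = 1 := by
    have := pow_mul_pow_of_swap haz.symm hswap p
    rw [← mem_center_iff.mp hzp w] at this
    exact (right_eq_mul.mp this)
  have haZ : a ∈ center G :=
    mem_of_pow_mem_of_coprime hcop (hap ▸ one_mem _) (hpowN a haN)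
  have haq : a ^ q ^ 2 = 1 := by
    have hswap' : w * z = a⁻¹ * (z * w) := by rw [hswap, inv_mul_cancel_left]
    have := pow_mul_pow_of_swap (mem_center_iff.mp (inv_mem haZ) w) hswap' (q ^ 2)
    rw [← mem_center_iff.mp (hpowN w hw) z] at this
    simpa using right_eq_mul.mp this
  have hwz : w ∈ centralizer {z} := by
    rw [eq_one_of_pow_eq_one_of_coprime_s16 hcop hap haq, one_mul] at hswap
    exact mem_centralizer_singleton_iff.mpr hswap.symm
  have hNz : N ≤ centralizer {z} := le_of_relIndex_prime inf_le_right (hAN ▸ hq) hw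
    (fun h => hwx h.1) (hAC z hxz) hwz
  exact hzN (hZN (mem_center_of_le_centralizer_of_index_prime (hidx ▸ hp) hNz hzN
    (self_mem_centralizer z)))

theorem _root_.Set.ncard_image_mul_of_fiber {α β : Type*} {f : α → β} {s : Set α} (hs : s.Finite)
    {m : ℕ} (h : ∀ x ∈ s, {y ∈ s | f y = f x}.ncard = m) : (f '' s).ncard * m = s.ncard := by
  classical
  lift s to Finset α using hs
  rw [Set.ncard_coe_finset, Finset.card_eq_sum_card_image f, Finset.sum_const_nat (m := m),
    ← Finset.coe_image, Set.ncard_coe_finset]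
  intro b hb
  obtain ⟨x, hx, rfl⟩ := Finset.mem_image.mp hb
  rw [← h x hx, ← Set.ncard_coe_finset]
  simp

theorem ncard_sdiff_of_le [Finite G] {K A : Subgroup G} (h : K ≤ A) :
    ((A : Set G) \ K).ncard = (K.relIndex A - 1) * Nat.card K := by
  have hmul := relIndex_mul_relIndex ⊥ K A bot_le h
  rw [relIndex_bot_left, relIndex_bot_left] at hmul
  rw [Set.ncard_sdiff h, Nat.sub_mul, one_mul, mul_comm, hmul]
  rfl

theorem ncard_image_centralizer_mul [Finite G] {S : Set G} {r : ℕ} (hr : r.Prime)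
    (hS : ∀ x ∈ S, x ∉ center G) (hrel : ∀ x ∈ S, (center G).relIndex (centralizer {x}) = r)
    (hcl : ∀ x ∈ S, ∀ y ∈ centralizer {x}, y ∉ center G → y ∈ S) :
    ((fun x : G => centralizer {x}) '' S).ncard * ((r - 1) * Nat.card (center G)) = S.ncard := by
  refine Set.ncard_image_mul_of_fiber S.toFinite fun x hx => ?_
  have hle : ∀ u ∈ S, ∀ v ∈ centralizer {u}, centralizer {u} ≤ centralizer {v} := fun u hu v hv =>
    le_centralizer_of_relIndex_center_prime (center_le_centralizer _) (hrel u hu ▸ hr) hv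
  rw [← hrel x hx, ← ncard_sdiff_of_le (center_le_centralizer _)]
  congr 1
  ext y
  refine ⟨fun ⟨hy, hyx⟩ => ⟨?_, hS y hy⟩, fun ⟨hy, hyZ⟩ => ⟨hcl x hx y hy hyZ, ?_⟩⟩
  · exact hyx ▸ self_mem_centralizer y
  · exact le_antisymm (hle y (hcl x hx y hy hyZ) x (mem_centralizer_comm.mp hy)) (hle x hx y hy)

theorem ncard_image_centralizer_compl [Finite G] {N : Subgroup G} [N.Normal] {p q : ℕ}
    (hp : p.Prime) (hZN : center G ≤ N) (hidx : N.index = p)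
    (hrel : (center G).relIndex N = q ^ 2)
    (hN : ∀ x ∈ N, x ∉ center G → centralizer {x} ≤ N) :
    ((fun x : G => centralizer {x}) '' (N : Set G)ᶜ).ncard = q ^ 2 := by
  have hinf : ∀ x ∉ N, centralizer {x} ⊓ N = center G := fun x hx =>
    le_antisymm (fun y hy => by_contra fun hyZ => hx (hN y hy.2 hyZ (mem_centralizer_comm.mp hy.1)))
      (le_inf (center_le_centralizer _) hZN)
  have h := ncard_image_centralizer_mul (S := (N : Set G)ᶜ) hp (fun x hx h => hx (hZN h))
    (fun x hx => by
      rw [← hinf x hx, inf_relIndex_left]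
      refine ((Nat.dvd_prime hp).mp (hidx ▸ relIndex_dvd_index_of_normal N _)).resolve_left ?_
      exact fun h => hx (relIndex_eq_one.mp h (self_mem_centralizer x)))
    (fun x hx y hy hyZ hyN => hyZ (hinf x hx ▸ ⟨hy, hyN⟩))
  have hcard := ncard_sdiff_of_le (le_top : N ≤ ⊤)
  rw [relIndex_top_right, hidx, coe_top, ← Set.compl_eq_univ_sdiff] at hcard
  have hNcard := relIndex_mul_relIndex ⊥ (center G) N bot_le hZN
  rw [relIndex_bot_left, relIndex_bot_left, hrel] at hNcard
  rw [hcard, ← hNcard] at h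
  refine Nat.eq_of_mul_eq_mul_right
    (Nat.mul_pos (Nat.sub_pos_of_lt hp.one_lt) (Nat.card_pos (α := center G))) (h.trans ?_)
  ring

theorem ncard_image_centralizer_sdiff [Finite G] {N : Subgroup G} {q : ℕ}
    (hq : q.Prime) (hZN : center G ≤ N) (hrel : (center G).relIndex N = q ^ 2)
    (hN : ∀ x ∈ N, x ∉ center G → centralizer {x} ≤ N) :
    ((fun x : G => centralizer {x}) '' ((N : Set G) \ center G)).ncard = 1 ∨
      ((fun x : G => centralizer {x}) '' ((N : Set G) \ center G)).ncard = q + 1 := by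
  by_cases hab : ∃ x ∈ N, x ∉ center G ∧ N ≤ centralizer {x}
  · left
    obtain ⟨x, hx, hxZ, hNx⟩ := hab
    rw [Set.ncard_eq_one]
    refine ⟨N, Set.eq_singleton_iff_unique_mem.mpr
      ⟨⟨x, ⟨hx, hxZ⟩, le_antisymm (hN x hx hxZ) hNx⟩, ?_⟩⟩
    rintro _ ⟨u, ⟨hu, huZ⟩, rfl⟩
    exact le_antisymm (hN u hu huZ) (commute_of_mem_of_le_centralizer hq hZN hrel hx hxZ hNx hu)
  · right
    push Not at hab
    have h := ncard_image_centralizer_mul (S := (N : Set G) \ center G) hq (fun x hx => hx.2)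
      (fun x hx => by
        rw [← (relIndex_centralizer_inf hq hZN hrel hx.1 hx.2 (hab x hx.1 hx.2)).1,
          inf_eq_left.mpr (hN x hx.1 hx.2)])
      (fun x hx y hy hyZ => ⟨hN x hx.1 hx.2 hy, hyZ⟩)
    rw [ncard_sdiff_of_le hZN, hrel] at h
    refine Nat.eq_of_mul_eq_mul_right
      (Nat.mul_pos (Nat.sub_pos_of_lt hq.one_lt) (Nat.card_pos (α := center G))) (h.trans ?_)
    rw [← mul_assoc, ← Nat.sq_sub_sq, one_pow]

theorem exists_normal_of_card_quotient_center [Finite G] {p q : ℕ} (hp : p.Prime) (hq : q.Prime)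
    (hpq : p < q) (h : Nat.card (G ⧸ center G) = p * q ^ 2) :
    ∃ N : Subgroup G, N.Normal ∧ center G ≤ N ∧ N.index = p ∧
      (center G).relIndex N = q ^ 2 ∧ ∀ a ∈ N, ∀ b ∈ N, ⁅a, b⁆ ∈ center G := by
  have := Fact.mk hq
  obtain ⟨P, hP⟩ := Sylow.exists_subgroup_card_pow_prime (G := G ⧸ center G) q (n := 2)
    (h ▸ dvd_mul_left _ _)
  have hPi : P.index = p := by
    have := P.card_mul_index
    rw [hP, h, mul_comm] at this
    exact Nat.eq_of_mul_eq_mul_right (pow_pos hq.pos 2) this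
  have hPn : P.Normal := by
    refine normal_of_index_eq_minFac_card (hPi.trans ?_)
    rw [h]
    refine le_antisymm ?_ (Nat.minFac_le_of_dvd hp.two_le (dvd_mul_right _ _))
    have hr := Nat.minFac_prime (n := p * q ^ 2) fun h1 =>
      hp.one_lt.ne' (Nat.eq_one_of_mul_eq_one_right h1)
    have hdvd := Nat.minFac_dvd (p * q ^ 2)
    rcases (hr.dvd_mul).mp hdvd with hd | hd
    · exact ((Nat.prime_dvd_prime_iff_eq hr hp).mp hd).ge
    · exact ((Nat.prime_dvd_prime_iff_eq hr hq).mp (hr.dvd_of_dvd_pow hd)).symm ▸ hpq.le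
  have hZ : center G ≤ P.comap (QuotientGroup.mk' (center G)) := fun z hz => by
    rw [mem_comap, QuotientGroup.mk'_apply, (QuotientGroup.eq_one_iff z).mpr hz]
    exact one_mem P
  have hi : (P.comap (QuotientGroup.mk' (center G))).index = p := by
    rw [index_comap_of_surjective P (QuotientGroup.mk'_surjective _), hPi]
  refine ⟨P.comap (QuotientGroup.mk' (center G)), inferInstance, hZ, hi, ?_, fun a ha b hb => ?_⟩
  · have := relIndex_mul_index hZ
    rw [hi, index, h, mul_comm] at this
    exact Nat.eq_of_mul_eq_mul_left hp.pos this
  · have hc := (IsPGroup.isMulCommutative_of_card_eq_prime_sq hP).is_comm.comm ⟨_, ha⟩ ⟨_, hb⟩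
    rw [← QuotientGroup.eq_one_iff, commutatorElement_def]
    have hc' : (a : G ⧸ center G) * b = b * a := congrArg Subtype.val hc
    simp [hc']

end Subgroup

theorem Cent_eq_insert_union {G : Type*} [Group G] {N : Subgroup G} (hZN : Subgroup.center G ≤ N) :
    Cent G = insert ⊤
      ((fun x : G => Subgroup.centralizer {x}) '' ((N : Set G) \ Subgroup.center G) ∪
        (fun x : G => Subgroup.centralizer {x}) '' (N : Set G)ᶜ) := by
  have hS : {x : G | x ∉ Subgroup.center G} = ((N : Set G) \ Subgroup.center G) ∪ (N : Set G)ᶜ := by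
    ext x
    have := @hZN x
    simp only [Set.mem_ofPred_eq, Set.mem_union, Set.mem_sdiff, SetLike.mem_coe, Set.mem_compl_iff]
    tauto
  rw [← Set.image_union, ← hS]
  ext H
  constructor
  · rintro ⟨x, rfl⟩
    by_cases hx : x ∈ Subgroup.center G
    · exact Or.inl (Subgroup.centralizer_eq_top_iff_mem_center.mpr hx)
    · exact Or.inr ⟨x, hx, rfl⟩
  · rintro (rfl | ⟨x, -, rfl⟩)
    · exact ⟨1, (Subgroup.centralizer_eq_top_iff_mem_center.mpr (one_mem _)).symm⟩
    · exact ⟨x, rfl⟩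

theorem card_cent_of_central_quotient_p_q_sq
    (G : Type*) [Group G] [Finite G] (p q : ℕ)
    (hp : p.Prime) (hq : q.Prime) (hpq : p < q)
    (h : Nat.card (G ⧸ Subgroup.center G) = p * q ^ 2) :
    (Cent G).ncard = q ^ 2 + 2 ∨ (Cent G).ncard = q ^ 2 + q + 2 := by
  obtain ⟨N, hNn, hZN, hidx, hrel, hcomm⟩ :=
    Subgroup.exists_normal_of_card_quotient_center hp hq hpq h
  have hN : ∀ x ∈ N, x ∉ Subgroup.center G → Subgroup.centralizer {x} ≤ N :=
    fun x hx hxZ y hy => by_contra fun hyN =>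
      Subgroup.not_commute_of_mem_of_notMem hp hq hpq.ne hZN hidx hrel hcomm hx hxZ hyN
        (Subgroup.mem_centralizer_singleton_iff.mp hy).symm
  have hout := Subgroup.ncard_image_centralizer_compl hp hZN hidx hrel hN
  have hin := Subgroup.ncard_image_centralizer_sdiff hq hZN hrel hN
  rw [Cent_eq_insert_union hZN, Set.ncard_insert_of_notMem, Set.ncard_union_eq, hout]
  · omega
  · rw [Set.disjoint_left]
    rintro _ ⟨x, hx, rfl⟩ ⟨y, hy, hyx⟩
    exact hy (hN x hx.1 hx.2 (hyx.le (Subgroup.self_mem_centralizer y)))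
  · rw [← Set.image_union]
    rintro ⟨x, hx, hxt⟩
    have hxZ := Subgroup.centralizer_eq_top_iff_mem_center.mp hxt
    exact hx.elim (fun hx => hx.2 hxZ) (fun hx => hx (hZN hxZ))
end
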